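/- arXiv:2511.06498 — 2 statements merged into one kernel-verified Lean document; each statement's English description precedes it below -/
import Mathlib

section
/- Characterization of the conditional convex order by the bivariate concordance order (Theorem 1.3). Let U, V be independent, uniformly distributed on (0,1). Let (F_u)_{u∈(0,1)} and (F'_u)_{u∈(0,1)} be rearranged conditional distribution families for (Y,X) and (Y',X') respectively, with rearranged quantile transforms q^{↑u}_{Y|X} and q^{↑u}_{Y'|X'}. Then the following are equivalent: (i) (Y,X) ⪯ccx (Y',X'); (ii) (F_Y(q^{↑U}_{Y|X}(V)), U) ≤c (F_{Y'}(q^{↑U}_{Y'|X'}(V)), U). Moreover, (Y,X) =ccx (Y',X') if and only if (F_Y(q^{↑U}_{Y|X}(V)), U) and (F_{Y'}(q^{↑U}_{Y'|X'}(V)), U) have the same distribution. -/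
open MeasureTheory ProbabilityTheory Set Filter

noncomputable section

namespace CCXPaper

variable {Ω Ω' : Type*} [MeasurableSpace Ω] [MeasurableSpace Ω']

/-- A measure is non-atomic in the measure-theoretic sense: every set of positive
measure contains a measurable subset of strictly smaller positive measure. -/
def Nonatomic (P : Measure Ω) : Prop :=
  ∀ s : Set Ω, MeasurableSet s → 0 < P s →
    ∃ t : Set Ω, MeasurableSet t ∧ t ⊆ s ∧ 0 < P t ∧ P t < P s

/-- Cumulative distribution function of the real random variable `Y` under `P`. -/
def cdfRV (P : Measure Ω) (Y : Ω → ℝ) (y : ℝ) : ℝ :=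
  (P {ω | Y ω ≤ y}).toReal

/-- Quantile function `q_Y(v) = inf {y | F_Y(y) ≥ v}`. -/
def quantRV (P : Measure Ω) (Y : Ω → ℝ) (v : ℝ) : ℝ :=
  sInf {y : ℝ | v ≤ cdfRV P Y y}

/-- Convex order between real random variables (on possibly different spaces):
`E[φ(S)] ≤ E[φ(T)]` for every convex `φ : ℝ → ℝ`. -/
def CxLE (P : Measure Ω) (S : Ω → ℝ) (P' : Measure Ω') (T : Ω' → ℝ) : Prop :=
  ∀ φ : ℝ → ℝ, ConvexOn ℝ Set.univ φ →
    ∫ ω, φ (S ω) ∂P ≤ ∫ ω, φ (T ω) ∂P'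

/-- Conditional probability `P(s | X)` as a random variable (a version of the
conditional expectation of the indicator of `s` given `σ(X)`). -/
def condProb {β : Type*} [MeasurableSpace β] (P : Measure Ω) (X : Ω → β) (s : Set Ω) :
    Ω → ℝ :=
  P[s.indicator (fun _ => (1 : ℝ)) | MeasurableSpace.comap X inferInstance]

/-- Conditional survival probability `P(Y ≥ y | X)`. -/
def condProbGE {β : Type*} [MeasurableSpace β] (P : Measure Ω) (Y : Ω → ℝ) (X : Ω → β)
    (y : ℝ) : Ω → ℝ :=
  condProb P X {ω | y ≤ Y ω}

/-- Conditional strict survival probability `P(Y > y | X)`. -/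
def condProbGT {β : Type*} [MeasurableSpace β] (P : Measure Ω) (Y : Ω → ℝ) (X : Ω → β)
    (y : ℝ) : Ω → ℝ :=
  condProb P X {ω | y < Y ω}

/-- Conditional cumulative probability `P(Y ≤ y | X)`. -/
def condProbLE {β : Type*} [MeasurableSpace β] (P : Measure Ω) (Y : Ω → ℝ) (X : Ω → β)
    (y : ℝ) : Ω → ℝ :=
  condProb P X {ω | Y ω ≤ y}

/-- Conditional strict cumulative probability `P(Y < y | X)`. -/
def condProbLT {β : Type*} [MeasurableSpace β] (P : Measure Ω) (Y : Ω → ℝ) (X : Ω → β)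
    (y : ℝ) : Ω → ℝ :=
  condProb P X {ω | Y ω < y}

/-- The conditional convex order `(Y, X) ⪯ccx (Y', X')`:
`P(Y ≥ q_Y(v) | X) ≤cx P(Y' ≥ q_{Y'}(v) | X')` for all `v ∈ (0,1)`. -/
def CCX {β γ : Type*} [MeasurableSpace β] [MeasurableSpace γ]
    (P : Measure Ω) (Y : Ω → ℝ) (X : Ω → β)
    (P' : Measure Ω') (Y' : Ω' → ℝ) (X' : Ω' → γ) : Prop :=
  ∀ v ∈ Set.Ioo (0 : ℝ) 1,
    CxLE P (condProbGE P Y X (quantRV P Y v)) P' (condProbGE P' Y' X' (quantRV P' Y' v))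

/-- Equality in the conditional convex order: `(Y, X) =ccx (Y', X')`. -/
def CCXeq {β γ : Type*} [MeasurableSpace β] [MeasurableSpace γ]
    (P : Measure Ω) (Y : Ω → ℝ) (X : Ω → β)
    (P' : Measure Ω') (Y' : Ω' → ℝ) (X' : Ω' → γ) : Prop :=
  CCX P Y X P' Y' X' ∧ CCX P' Y' X' P Y X

/-- `Y` and `Z` are conditionally independent given `X`: for every Borel `B ⊆ ℝ`,
`P(Y ∈ B | (X, Z)) = P(Y ∈ B | X)` almost surely. -/
def CondIndepGiven {β γ : Type*} [MeasurableSpace β] [MeasurableSpace γ]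
    (P : Measure Ω) (Y : Ω → ℝ) (Z : Ω → γ) (X : Ω → β) : Prop :=
  ∀ B : Set ℝ, MeasurableSet B →
    condProb P (fun ω => (X ω, Z ω)) (Y ⁻¹' B) =ᵐ[P] condProb P X (Y ⁻¹' B)

/-- `Y` is perfectly dependent on `X`: `Y = f(X)` a.s. for some measurable `f`. -/
def PerfectDep {β : Type*} [MeasurableSpace β] (P : Measure Ω) (Y : Ω → ℝ) (X : Ω → β) :
    Prop :=
  ∃ f : β → ℝ, Measurable f ∧ Y =ᵐ[P] fun ω => f (X ω)

/-- Concordance order for bivariate random vectors `(T, S) ≤c (T', S')`. -/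
def ConcordLE (P : Measure Ω) (T S : Ω → ℝ) (P' : Measure Ω') (T' S' : Ω' → ℝ) : Prop :=
  ∀ t s : ℝ,
    P {ω | T ω ≤ t ∧ S ω ≤ s} ≤ P' {ω | T' ω ≤ t ∧ S' ω ≤ s} ∧
    P {ω | t < T ω ∧ s < S ω} ≤ P' {ω | t < T' ω ∧ s < S' ω}

/-- The bivariate random vector `(W₁, W₂)` is stochastically increasing (SI):
for each bounded increasing `f`, a version of `E[f(W₁) | W₂]` is an increasing
function of `W₂`. -/
def SIvec (P : Measure Ω) (W₁ W₂ : Ω → ℝ) : Prop :=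
  ∀ f : ℝ → ℝ, Monotone f → (∃ C : ℝ, ∀ x, |f x| ≤ C) →
    ∃ m : ℝ → ℝ, Monotone m ∧
      (fun ω => m (W₂ ω)) =ᵐ[P]
        P[(fun ω => f (W₁ ω)) | MeasurableSpace.comap W₂ inferInstance]

/-- `G` is a cumulative distribution function on `ℝ`. -/
def IsCDF (G : ℝ → ℝ) : Prop :=
  Monotone G ∧ (∀ y : ℝ, ContinuousWithinAt G (Set.Ici y) y) ∧
    Tendsto G atBot (nhds 0) ∧ Tendsto G atTop (nhds 1)

/-- `(F u)_{u ∈ (0,1)}` is a rearranged conditional distribution family for `(Y, X)`: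
each `F u` is a cdf, `u ↦ F u y` is decreasing, and for each `y` the function
`u ↦ F u y` on `(0,1)` is a rearrangement of (i.e. equidistributed with)
`P(Y ≤ y | X)`. -/
def IsRearrangedFamily {β : Type*} [MeasurableSpace β]
    (P : Measure Ω) (Y : Ω → ℝ) (X : Ω → β) (F : ℝ → ℝ → ℝ) : Prop :=
  (∀ u ∈ Set.Ioo (0 : ℝ) 1, IsCDF (F u)) ∧
  (∀ y : ℝ, AntitoneOn (fun u => F u y) (Set.Ioo (0 : ℝ) 1)) ∧
  (∀ y w : ℝ,
    volume {u ∈ Set.Ioo (0 : ℝ) 1 | w ≤ F u y} = P {ω | w ≤ condProbLE P Y X y ω})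

/-- Rearranged quantile transform `q^{↑u}_{Y|X}(t) = inf {y | F_u(y) ≥ t}`. -/
def qArr (F : ℝ → ℝ → ℝ) (u t : ℝ) : ℝ :=
  sInf {y : ℝ | t ≤ F u y}

/-- The uniform distribution on `(0,1)`. -/
def unif01 : Measure ℝ := volume.restrict (Set.Ioo (0 : ℝ) 1)

/-- `hs` is a decreasing rearrangement of `h : (0,1)^k → ℝ`. -/
def IsDecRearrangement {k : ℕ} (h : (Fin k → ℝ) → ℝ) (hs : ℝ → ℝ) : Prop :=
  AntitoneOn hs (Set.Ioo (0 : ℝ) 1) ∧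
  ∀ w : ℝ,
    volume {t ∈ Set.Ioo (0 : ℝ) 1 | w ≤ hs t} =
      volume {x ∈ Set.pi Set.univ (fun _ : Fin k => Set.Ioo (0 : ℝ) 1) | w ≤ h x}

/-- Schur order `f ≺_S g` for functions on unit cubes, via decreasing rearrangements. -/
def SchurLE {d d' : ℕ} (f : (Fin d → ℝ) → ℝ) (g : (Fin d' → ℝ) → ℝ) : Prop :=
  ∃ fs gs : ℝ → ℝ, IsDecRearrangement f fs ∧ IsDecRearrangement g gs ∧
    (∀ x ∈ Set.Ioo (0 : ℝ) 1,
      (∫ t in Set.Ioo (0 : ℝ) x, fs t) ≤ ∫ t in Set.Ioo (0 : ℝ) x, gs t) ∧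
    (∫ t in Set.Ioo (0 : ℝ) 1, fs t) = ∫ t in Set.Ioo (0 : ℝ) 1, gs t

/-- `κ` is a Markov-kernel version of the conditional cdf of `Y` given `X`. -/
def IsCondCDFKernel {β : Type*} [MeasurableSpace β]
    (P : Measure Ω) (Y : Ω → ℝ) (X : Ω → β) (κ : β → ℝ → ℝ) : Prop :=
  (∀ y : ℝ, Measurable fun x => κ x y) ∧
  ∀ y : ℝ, (fun ω => κ (X ω) y) =ᵐ[P] condProbLE P Y X y

/-- The dependence measure `ξ_φ(Y, X)` (with conditional cdf kernel `κ`). -/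
def xiPhi {β : Type*} [MeasurableSpace β] (P : Measure Ω) (Y : Ω → ℝ) (X : Ω → β)
    (κ : β → ℝ → ℝ) (φ : ℝ → ℝ) : ℝ :=
  (∫ y1, ∫ y, φ ((if y1 ≤ y then (1 : ℝ) else 0) - cdfRV P Y y) ∂(P.map Y) ∂(P.map Y))⁻¹ *
    ∫ x, ∫ y, φ (κ x y - cdfRV P Y y) ∂(P.map Y) ∂(P.map X)

/-- The dependence measure `Λ_φ(Y, X)` (with conditional cdf kernel `κ`). -/
def LamPhi {β : Type*} [MeasurableSpace β] (P : Measure Ω) (Y : Ω → ℝ) (X : Ω → β)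
    (κ : β → ℝ → ℝ) (φ : ℝ → ℝ) : ℝ :=
  (∫ y12 : ℝ × ℝ, ∫ y,
      φ ((if y12.1 ≤ y then (1 : ℝ) else 0) - if y12.2 ≤ y then (1 : ℝ) else 0)
      ∂(P.map Y) ∂((P.map Y).prod (P.map Y)))⁻¹ *
    ∫ x12 : β × β, ∫ y, φ (κ x12.1 y - κ x12.2 y) ∂(P.map Y) ∂((P.map X).prod (P.map X))

/-- `φ` vanishes at `0` and is strictly convex at `0`. -/
def StrictlyConvexAtZero (φ : ℝ → ℝ) : Prop :=
  φ 0 = 0 ∧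
    ∀ s t lam : ℝ, s < 0 → 0 < t → 0 < lam → lam < 1 → lam * s + (1 - lam) * t = 0 →
      0 < lam * φ s + (1 - lam) * φ t

/-- `μ` is the (possibly degenerate) Gaussian distribution `N(m, S)` on `ℝ^d`,
characterized via its characteristic function. -/
def IsGaussianPi {d : ℕ} (μ : Measure (Fin d → ℝ)) (m : Fin d → ℝ)
    (S : Matrix (Fin d) (Fin d) ℝ) : Prop :=
  ∀ t : Fin d → ℝ,
    (∫ x, Complex.exp (Complex.I * ((∑ i, t i * x i : ℝ) : ℂ)) ∂μ) =
      Complex.exp (Complex.I * ((∑ i, t i * m i : ℝ) : ℂ) -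
        ((∑ i, ∑ j, t i * S i j * t j : ℝ) : ℂ) / 2)

/-- `Y` and `X` are comonotone. -/
def Comonotone (P : Measure Ω) (Y X : Ω → ℝ) : Prop :=
  ∃ U : Ω → ℝ, Measurable U ∧ P.map U = unif01 ∧
    P.map (fun ω => (Y ω, X ω)) =
      P.map (fun ω => (quantRV P Y (U ω), quantRV P X (U ω)))

/-- `Y` and `X` are countermonotone. -/
def Countermonotone (P : Measure Ω) (Y X : Ω → ℝ) : Prop :=
  ∃ U : Ω → ℝ, Measurable U ∧ P.map U = unif01 ∧
    P.map (fun ω => (Y ω, X ω)) =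
      P.map (fun ω => (quantRV P Y (U ω), quantRV P X (1 - U ω)))

end CCXPaper


namespace CCXPaper

section Helpers

lemma exists_subgrad {φ : ℝ → ℝ} (hφ : ConvexOn ℝ Set.univ φ) :
    ∃ d : ℝ → ℝ, Monotone d ∧ ∀ x y, φ x + d x * (y - x) ≤ φ y := by
  refine ⟨fun x => derivWithin φ (Ioi x) x, ?_, ?_⟩
  · have := hφ.monotoneOn_rightDeriv
    simpa [monotoneOn_univ] using this
  · intro x y
    rcases lt_trichotomy x y with h | h | h
    · have h1 := hφ.rightDeriv_le_slope_of_mem_interior (x := x) (y := y) (by simp) (by simp) h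
      rw [slope_def_field, le_div_iff₀ (by linarith)] at h1
      linarith
    · subst h; simp
    · have h1 := hφ.slope_le_leftDeriv_of_mem_interior (x := y) (y := x) (by simp) (by simp) h
      have h2 := hφ.leftDeriv_le_rightDeriv_of_mem_interior (x := x) (by simp)
      have h3 := h1.trans h2
      rw [slope_def_field, div_le_iff₀ (by linarith)] at h3
      simp only
      linarith

instance : IsProbabilityMeasure unif01 := ⟨by simp [unif01]⟩

instance : NullSingletonClass unif01 := by unfold unif01; infer_instance

lemma unif01_ae : ∀ᵐ u ∂unif01, u ∈ Ioo (0:ℝ) 1 := by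
  unfold unif01
  exact ae_restrict_mem measurableSet_Ioo

lemma unif01_Iic {a : ℝ} (_h0 : 0 ≤ a) (h1 : a ≤ 1) : unif01 (Iic a) = ENNReal.ofReal a := by
  have : unif01 (Iic a) = unif01 (Iio a) := measure_congr Iio_ae_eq_Iic.symm
  rw [this, unif01, Measure.restrict_apply measurableSet_Iio, inter_comm, Ioo_inter_Iio, min_eq_right h1]
  simp

lemma integrable_of_bdd {α : Type*} [MeasurableSpace α] {μ : Measure α} [IsFiniteMeasure μ]
    {f : α → ℝ} (hf : Measurable f) (C : ℝ) (hC : ∀ x, |f x| ≤ C) : Integrable f μ :=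
  Integrable.of_bound hf.aestronglyMeasurable C (Eventually.of_forall hC)

lemma exists_bound_cont {φ : ℝ → ℝ} (hφ : Continuous φ) :
    ∃ C, ∀ x ∈ Icc (0:ℝ) 1, |φ x| ≤ C := by
  obtain ⟨C, hC⟩ := isCompact_Icc.exists_bound_of_continuousOn (hφ.continuousOn (s := Icc (0:ℝ) 1))
  exact ⟨C, hC⟩

lemma convex_cont {φ : ℝ → ℝ} (hφ : ConvexOn ℝ Set.univ φ) : Continuous φ := by
  have := hφ.continuousOn isOpen_univ
  exact continuousOn_univ.1 this

/-- Initial segments suffice for testing against decreasing sets. -/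
lemma seg_nonneg {k : ℝ → ℝ}
    (hseg : ∀ s : ℝ, 0 ≤ ∫ u in Iic s, k u ∂unif01) {h : ℝ → ℝ} (hh : Antitone h) (c : ℝ) :
    0 ≤ ∫ u in {u | c < h u}, k u ∂unif01 := by
  set A := {u | c < h u} with hA
  have hlow : ∀ u v, u ≤ v → v ∈ A → u ∈ A := fun u v huv hv => lt_of_lt_of_le hv (hh huv)
  by_cases hne : A.Nonempty
  · by_cases hb : BddAbove A
    · have : A =ᵐ[unif01] Iic (sSup A) := by
        have h1 : A ⊆ Iic (sSup A) := fun u hu => le_csSup hb hu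
        have h2 : Iio (sSup A) ⊆ A := fun u hu => by
          obtain ⟨v, hv, huv⟩ := exists_lt_of_lt_csSup hne hu
          exact hlow u v huv.le hv
        have h3 : Iio (sSup A) =ᵐ[unif01] Iic (sSup A) := Iio_ae_eq_Iic
        exact h1.eventuallyLE.antisymm (h3.symm.le.trans h2.eventuallyLE)
      rw [setIntegral_congr_set this]
      exact hseg _
    · have : A = univ := by
        ext u
        simp only [mem_univ, iff_true]
        rw [not_bddAbove_iff] at hb
        obtain ⟨v, hv, huv⟩ := hb u
        exact hlow u v huv.le hv
      have h1 : (univ : Set ℝ) =ᵐ[unif01] Iic 1 := by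
        filter_upwards [unif01_ae] with u hu
        simp only [eq_iff_iff]
        exact ⟨fun _ => hu.2.le, fun _ => trivial⟩
      rw [this, setIntegral_congr_set h1]
      exact hseg _
  · rw [not_nonempty_iff_eq_empty] at hne
    rw [hne]; simp

lemma anti_integral_nonneg {k h : ℝ → ℝ} (hk : Measurable k) (hkb : ∀ u, |k u| ≤ 1)
    (hseg : ∀ s : ℝ, 0 ≤ ∫ u in Iic s, k u ∂unif01) (h0 : ∫ u, k u ∂unif01 = 0)
    (hh : Antitone h) {a b : ℝ} (ha : ∀ u, a ≤ h u) (hb : ∀ u, h u ≤ b) :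
    0 ≤ ∫ u, h u * k u ∂unif01 := by
  have hhm : Measurable h := hh.measurable
  have key : ∀ u, (h u - a) * k u = ∫ c in Icc a b, {c | c < h u}.indicator (fun _ => k u) c := by
    intro u
    change _ = ∫ c in Icc a b, (Iio (h u)).indicator (fun _ => k u) c
    rw [integral_indicator measurableSet_Iio, Measure.restrict_restrict measurableSet_Iio]
    have : (Iio (h u)) ∩ Icc a b = Ico a (h u) := by
      ext c; simp only [mem_inter_iff, mem_Iio, mem_Icc, mem_Ico]
      exact ⟨fun h => ⟨h.2.1, h.1⟩, fun h' => ⟨h'.2, h'.1, h'.2.le.trans (hb u)⟩⟩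
    change _ = ∫ c in (Iio (h u)) ∩ Icc a b, k u
    rw [this]
    simp [ha u]
  have hint : Integrable (fun u => h u * k u) unif01 := by
    refine integrable_of_bdd (hhm.mul hk) (max |a| |b| * 1) fun u => ?_
    rw [abs_mul]
    exact mul_le_mul (abs_le_max_abs_abs (ha u) (hb u)) (hkb u) (abs_nonneg _) (by positivity)
  have hki : Integrable k unif01 := integrable_of_bdd hk 1 hkb
  have e1 : ∫ u, h u * k u ∂unif01 = ∫ u, (h u - a) * k u ∂unif01 := by
    simp_rw [sub_mul]
    rw [integral_sub hint (hki.const_mul a), integral_const_mul, h0]; simp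
  rw [e1]
  simp_rw [key]
  rw [integral_integral_swap]
  · refine integral_nonneg fun c => ?_
    have := seg_nonneg hseg hh c
    rw [← integral_indicator (measurableSet_lt measurable_const hhm)] at this
    exact this
  · have hm : MeasurableSet {x : ℝ × ℝ | x.2 < h x.1} :=
      measurableSet_lt measurable_snd (hhm.comp measurable_fst)
    have : (Function.uncurry fun u c => {c | c < h u}.indicator (fun _ => k u) c)
        = {x : ℝ × ℝ | x.2 < h x.1}.indicator (fun x => k x.1) := by
      ext ⟨u, c⟩; rfl
    rw [this]
    refine integrable_of_bdd ((hk.comp measurable_fst).indicator hm) 1 fun x => ?_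
    unfold indicator; split_ifs
    · exact hkb _
    · simp

/-- Majorization criterion for the convex order of decreasing functions. -/
lemma majorization {f g : ℝ → ℝ} (hf : Antitone f) (hg : Antitone g)
    (hf0 : ∀ u, f u ∈ Icc (0:ℝ) 1) (hg0 : ∀ u, g u ∈ Icc (0:ℝ) 1) :
    (∀ φ : ℝ → ℝ, ConvexOn ℝ Set.univ φ → ∫ u, φ (f u) ∂unif01 ≤ ∫ u, φ (g u) ∂unif01) ↔
    ((∀ s : ℝ, ∫ u in Iic s, f u ∂unif01 ≤ ∫ u in Iic s, g u ∂unif01) ∧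
      ∫ u, f u ∂unif01 = ∫ u, g u ∂unif01) := by
  have bd : ∀ {f : ℝ → ℝ}, (∀ u, f u ∈ Icc (0:ℝ) 1) → ∀ u, |f u| ≤ 1 := fun h u =>
    abs_le.2 ⟨by linarith [(h u).1], (h u).2⟩
  have hfi : Integrable f unif01 := integrable_of_bdd hf.measurable 1 (bd hf0)
  have hgi : Integrable g unif01 := integrable_of_bdd hg.measurable 1 (bd hg0)
  constructor
  · intro H
    have heq : ∫ u, f u ∂unif01 = ∫ u, g u ∂unif01 := by
      apply le_antisymm
      · exact H id (convexOn_id convex_univ)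
      · have := H (fun x => -x) ((concaveOn_id convex_univ).neg)
        simp only [integral_neg] at this
        linarith
    refine ⟨fun s => ?_, heq⟩
    set c := g s with hc
    have hconv : ConvexOn ℝ Set.univ (fun x : ℝ => max (x - c) 0) := by
      have h1 : ConvexOn ℝ Set.univ (fun x : ℝ => x - c) :=
        (convexOn_id convex_univ).sub (concaveOn_const c convex_univ)
      exact h1.sup (convexOn_const 0 convex_univ)
    have hH := H _ hconv
    have mint : ∀ {f : ℝ → ℝ}, Integrable f unif01 →
        Integrable (fun u => max (f u - c) 0) unif01 := fun h =>
      (h.sub (integrable_const c)).pos_part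
    have e1 : ∫ u in Iic s, f u ∂unif01 = ∫ u in Iic s, (f u - c) ∂unif01
        + ∫ u in Iic s, c ∂unif01 := by
      rw [← integral_add]
      · simp
      · exact (hfi.sub (integrable_const c)).integrableOn
      · exact (integrable_const c)
    have e2 : ∫ u in Iic s, g u ∂unif01 = ∫ u in Iic s, (g u - c) ∂unif01
        + ∫ u in Iic s, c ∂unif01 := by
      rw [← integral_add]
      · simp
      · exact (hgi.sub (integrable_const c)).integrableOn
      · exact (integrable_const c)
    have e3 : ∫ u in Iic s, (f u - c) ∂unif01 ≤ ∫ u, max (f u - c) 0 ∂unif01 := by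
      calc _ ≤ ∫ u in Iic s, max (f u - c) 0 ∂unif01 :=
            integral_mono (hfi.sub (integrable_const c)).integrableOn (mint hfi).integrableOn
              fun u => le_max_left _ _
        _ ≤ _ := setIntegral_le_integral (mint hfi) (Eventually.of_forall fun u => le_max_right _ _)
    have e4 : ∫ u, max (g u - c) 0 ∂unif01 = ∫ u in Iic s, (g u - c) ∂unif01 := by
      rw [← integral_indicator measurableSet_Iic]
      congr 1
      ext u
      by_cases hu : u ≤ s
      · rw [indicator_of_mem (by exact hu), max_eq_left]
        linarith [hg hu]
      · rw [indicator_of_notMem (by exact hu), max_eq_right]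
        linarith [hg (not_le.1 hu).le]
    linarith
  · rintro ⟨H, heq⟩ φ hφ
    obtain ⟨d, hd, hsub⟩ := exists_subgrad hφ
    have hφc := convex_cont hφ
    obtain ⟨C, hC⟩ := exists_bound_cont hφc
    have hφf : Integrable (fun u => φ (f u)) unif01 :=
      integrable_of_bdd (hφc.measurable.comp hf.measurable) C fun u => hC _ (hf0 u)
    have hφg : Integrable (fun u => φ (g u)) unif01 :=
      integrable_of_bdd (hφc.measurable.comp hg.measurable) C fun u => hC _ (hg0 u)
    have hda : Antitone (fun u => d (f u)) := fun u v huv => hd (hf huv)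
    have hkb : ∀ u, |g u - f u| ≤ 1 := fun u =>
      abs_le.2 ⟨by linarith [(hf0 u).2, (hg0 u).1], by linarith [(hf0 u).1, (hg0 u).2]⟩
    have hmain := anti_integral_nonneg (k := fun u => g u - f u) (h := fun u => d (f u))
      (hg.measurable.sub hf.measurable) hkb
      (fun s => by
        rw [integral_sub hgi.integrableOn hfi.integrableOn]; linarith [H s])
      (by rw [integral_sub hgi hfi]; linarith) hda (a := d 0) (b := d 1)
      (fun u => hd (hf0 u).1) (fun u => hd (hf0 u).2)
    have hint : Integrable (fun u => d (f u) * (g u - f u)) unif01 := by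
      refine integrable_of_bdd (hda.measurable.mul (hg.measurable.sub hf.measurable))
        (max |d 0| |d 1| * 1) fun u => ?_
      rw [abs_mul]
      exact mul_le_mul (abs_le_max_abs_abs (hd (hf0 u).1) (hd (hf0 u).2)) (hkb u)
        (abs_nonneg _) (by positivity)
    have := integral_mono (hφf.add hint) hφg (fun u => hsub (f u) (g u))
    rw [integral_add' hφf hint] at this
    linarith

lemma antitone_ext {f : ℝ → ℝ} (hf : AntitoneOn f (Ioo (0:ℝ) 1))
    (h01 : ∀ u ∈ Ioo (0:ℝ) 1, f u ∈ Icc (0:ℝ) 1) :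
    ∃ g : ℝ → ℝ, Antitone g ∧ (∀ u, g u ∈ Icc (0:ℝ) 1) ∧ ∀ u ∈ Ioo (0:ℝ) 1, g u = f u := by
  obtain ⟨e, he, hfe⟩ := hf.exists_antitone_extension
    ⟨0, by rintro _ ⟨u, hu, rfl⟩; exact (h01 u hu).1⟩
    ⟨1, by rintro _ ⟨u, hu, rfl⟩; exact (h01 u hu).2⟩
  refine ⟨fun u => max 0 (min 1 (e u)), ?_, ?_, ?_⟩
  · intro u v huv
    exact max_le_max le_rfl (min_le_min le_rfl (he huv))
  · intro u
    exact ⟨le_max_left _ _, max_le zero_le_one (min_le_left _ _)⟩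
  · intro u hu
    have h := h01 u hu
    rw [hfe hu] at h
    simp only
    rw [min_eq_right h.2, max_eq_right h.1, hfe hu]

lemma isCDF_sInf_le {G : ℝ → ℝ} (hG : IsCDF G) {t : ℝ} (ht : t ∈ Ioo (0:ℝ) 1) (y : ℝ) :
    sInf {y : ℝ | t ≤ G y} ≤ y ↔ t ≤ G y := by
  obtain ⟨hm, hr, hbot, htop⟩ := hG
  have hne : {y : ℝ | t ≤ G y}.Nonempty :=
    ((htop.eventually (eventually_gt_nhds ht.2)).exists).imp fun y hy => le_of_lt hy
  have hbd : BddBelow {y : ℝ | t ≤ G y} := by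
    obtain ⟨z, hz⟩ := (hbot.eventually (eventually_lt_nhds ht.1)).exists
    refine ⟨z, fun y hy => ?_⟩
    by_contra hlt
    exact absurd (lt_of_le_of_lt (hm (not_le.1 hlt).le) hz) (not_lt.2 hy)
  constructor
  · intro h
    have h1 : ∀ z ∈ Ioi y, t ≤ G z := by
      intro z hz
      obtain ⟨w, hw, hwz⟩ := exists_lt_of_csInf_lt hne (lt_of_le_of_lt h hz)
      exact le_trans hw (hm hwz.le)
    have h2 : Tendsto G (nhdsWithin y (Ioi y)) (nhds (G y)) :=
      (hr y).mono Ioi_subset_Ici_self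
    exact ge_of_tendsto h2 (eventually_nhdsWithin_of_forall h1)
  · intro h
    exact csInf_le hbd h

lemma isCDF_mem {G : ℝ → ℝ} (hG : IsCDF G) (y : ℝ) : G y ∈ Icc (0:ℝ) 1 := by
  obtain ⟨hm, hr, hbot, htop⟩ := hG
  exact ⟨hm.le_of_tendsto hbot y, hm.ge_of_tendsto htop y⟩

lemma isCDF_cdfRV {Ω : Type*} [MeasurableSpace Ω] (P : Measure Ω) [IsProbabilityMeasure P]
    {Y : Ω → ℝ} (hY : Measurable Y) : IsCDF (cdfRV P Y) := by
  have : IsProbabilityMeasure (P.map Y) := Measure.isProbabilityMeasure_map hY.aemeasurable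
  have : cdfRV P Y = cdf (P.map Y) := by
    ext y
    rw [cdf_eq_real, measureReal_def, Measure.map_apply hY measurableSet_Iic]
    rfl
  rw [this]
  exact ⟨monotone_cdf _, fun y => (cdf (P.map Y)).right_continuous y, tendsto_cdf_atBot _,
    tendsto_cdf_atTop _⟩

lemma cdfRV_lt_iff {Ω : Type*} [MeasurableSpace Ω] (P : Measure Ω) [IsProbabilityMeasure P]
    {Y : Ω → ℝ} (hY : Measurable Y) {v : ℝ} (hv : v ∈ Ioo (0:ℝ) 1) (z : ℝ) :
    cdfRV P Y z < v ↔ z < quantRV P Y v := by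
  rw [← not_le, ← not_le, not_iff_not]
  exact (isCDF_sInf_le (isCDF_cdfRV P hY) hv z).symm

lemma measurable_condProb {Ω β : Type*} [MeasurableSpace Ω] [MeasurableSpace β] (P : Measure Ω)
    {X : Ω → β} (hX : Measurable X) (s : Set Ω) : Measurable (condProb P X s) :=
  (stronglyMeasurable_condExp.mono hX.comap_le).measurable

lemma condProb_ae {Ω β : Type*} [MeasurableSpace Ω] [MeasurableSpace β] (P : Measure Ω)
    [IsProbabilityMeasure P] {Y : Ω → ℝ} {X : Ω → β} (hY : Measurable Y) (hX : Measurable X)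
    {s : Set ℝ} (hs : MeasurableSet s) :
    condProb P X (Y ⁻¹' s) =ᵐ[P] fun ω => (condDistrib Y X P (X ω)).real s :=
  (condDistrib_ae_eq_condExp hX hY hs).symm

lemma ae_uv {Ω : Type*} [MeasurableSpace Ω] {P : Measure Ω} {U : Ω → ℝ} (hU : Measurable U)
    (hUlaw : P.map U = unif01) : ∀ᵐ ω ∂P, U ω ∈ Ioo (0:ℝ) 1 := by
  have h := unif01_ae
  rw [← hUlaw] at h
  exact ae_of_ae_map hU.aemeasurable h

/-- Joint law of the reduced vector at a fixed level. -/
lemma joint_le {Ω : Type*} [MeasurableSpace Ω] (P : Measure Ω) [IsProbabilityMeasure P]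
    {G : ℝ → ℝ} (hG : Antitone G) (hG0 : ∀ u, G u ∈ Icc (0:ℝ) 1)
    (U V : Ω → ℝ) (hU : Measurable U) (hV : Measurable V)
    (hUlaw : P.map U = unif01) (hVlaw : P.map V = unif01)
    (hUV : IndepFun U V P) (s : ℝ) :
    P {ω | V ω ≤ G (U ω) ∧ U ω ≤ s} = ENNReal.ofReal (∫ u in Iic s, G u ∂unif01) := by
  have hlaw := (indepFun_iff_map_prod_eq_prod_map_map hU.aemeasurable hV.aemeasurable).1 hUV
  rw [hUlaw, hVlaw] at hlaw
  have hm : MeasurableSet {x : ℝ × ℝ | x.2 ≤ G x.1 ∧ x.1 ≤ s} :=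
    (measurableSet_le measurable_snd (hG.measurable.comp measurable_fst)).inter
      (measurableSet_le measurable_fst measurable_const)
  have e : P {ω | V ω ≤ G (U ω) ∧ U ω ≤ s}
      = P.map (fun ω => (U ω, V ω)) {x : ℝ × ℝ | x.2 ≤ G x.1 ∧ x.1 ≤ s} := by
    rw [Measure.map_apply (hU.prodMk hV) hm]; rfl
  rw [e, hlaw, Measure.prod_apply hm, ofReal_integral_eq_lintegral_ofReal,
    ← lintegral_indicator measurableSet_Iic]
  · congr 1
    ext u
    by_cases hu : u ≤ s
    · rw [indicator_of_mem (by exact hu), ← unif01_Iic (hG0 u).1 (hG0 u).2]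
      congr 1
      ext v
      simp [hu]
    · rw [indicator_of_notMem (by exact hu)]
      have : Prod.mk u ⁻¹' {x : ℝ × ℝ | x.2 ≤ G x.1 ∧ x.1 ≤ s} = ∅ := by
        ext v; simp [hu]
      rw [this]; simp
  · exact (integrable_of_bdd hG.measurable 1 fun u =>
      abs_le.2 ⟨by linarith [(hG0 u).1], (hG0 u).2⟩)
  · exact Eventually.of_forall fun u => (hG0 u).1

lemma family_ext {Ω β : Type*} [MeasurableSpace Ω] [MeasurableSpace β] {P : Measure Ω}
    {Y : Ω → ℝ} {X : Ω → β} {F : ℝ → ℝ → ℝ} (hF : IsRearrangedFamily P Y X F) (y : ℝ) :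
    ∃ g : ℝ → ℝ, Antitone g ∧ (∀ u, g u ∈ Icc (0:ℝ) 1) ∧ ∀ u ∈ Ioo (0:ℝ) 1, g u = F u y :=
  antitone_ext (hF.2.1 y) fun u hu => isCDF_mem (hF.1 u hu) y

lemma repr_reduced {Ω β : Type*} [MeasurableSpace Ω] [MeasurableSpace β] (P : Measure Ω)
    [IsProbabilityMeasure P]
    {Y : Ω → ℝ} {X : Ω → β} (hY : Measurable Y) (hX : Measurable X)
    {F : ℝ → ℝ → ℝ} (hF : IsRearrangedFamily P Y X F)
    (U V : Ω → ℝ) (hU : Measurable U) (hV : Measurable V)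
    (hUlaw : P.map U = unif01) (hVlaw : P.map V = unif01)
    (hUV : IndepFun U V P) (q : ℝ) :
    ∃ f : ℝ → ℝ, Antitone f ∧ (∀ u, f u ∈ Icc (0:ℝ) 1) ∧
      (∀ φ : ℝ → ℝ, Continuous φ →
        ∫ u, φ (f u) ∂unif01 = ∫ ω, φ (1 - condProbGE P Y X q ω) ∂P) ∧
      ∀ s : ℝ, P {ω | qArr F (U ω) (V ω) < q ∧ U ω ≤ s}
        = ENNReal.ofReal (∫ u in Iic s, f u ∂unif01) := by
  obtain ⟨y, hymono, hyq, hylim⟩ := exists_seq_strictMono_tendsto q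
  choose G hGa hG0 hGF using fun n => family_ext hF (y n)
  have hyw : Tendsto y atTop (nhdsWithin q (Iio q)) :=
    tendsto_nhdsWithin_iff.2 ⟨hylim, Eventually.of_forall hyq⟩
  have hlim : ∀ u ∈ Ioo (0:ℝ) 1, Tendsto (fun n => F u (y n)) atTop
      (nhds (Function.leftLim (F u) q)) := fun u hu =>
    ((hF.1 u hu).1.tendsto_leftLim q).comp hyw
  obtain ⟨f, hfa, hf0, hfe⟩ := antitone_ext (f := fun u => Function.leftLim (F u) q)
    (fun u hu v hv huv => le_of_tendsto_of_tendsto' (hlim v hv) (hlim u hu)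
      fun n => hF.2.1 (y n) hu hv huv)
    (fun u hu => isClosed_Icc.mem_of_tendsto (hlim u hu)
      (Eventually.of_forall fun n => isCDF_mem (hF.1 u hu) _))
  have hGf : ∀ᵐ u ∂unif01, Tendsto (fun n => G n u) atTop (nhds (f u)) := by
    filter_upwards [unif01_ae] with u hu
    have := hlim u hu
    rw [hfe u hu]
    simpa only [hGF _ u hu] using this
  refine ⟨f, hfa, hf0, ?_, ?_⟩
  · intro φ hφ
    obtain ⟨C, hC⟩ := exists_bound_cont hφ
    have hκ : ∀ n, condProbLE P Y X (y n) =ᵐ[P] fun ω =>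
        (condDistrib Y X P (X ω)).real (Iic (y n)) := fun n =>
      condProb_ae P hY hX (s := Iic (y n)) measurableSet_Iic
    have hκ' : condProbGE P Y X q =ᵐ[P] fun ω =>
        (condDistrib Y X P (X ω)).real (Ici q) :=
      condProb_ae P hY hX (s := Ici q) measurableSet_Ici
    have hlaw : ∀ n, unif01.map (G n) = P.map (condProbLE P Y X (y n)) := by
      intro n
      have hm1 := (hGa n).measurable
      have hm2 : Measurable (condProbLE P Y X (y n)) := measurable_condProb P hX _
      have : IsProbabilityMeasure (unif01.map (G n)) :=
        Measure.isProbabilityMeasure_map hm1.aemeasurable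
      have : IsProbabilityMeasure (P.map (condProbLE P Y X (y n))) :=
        Measure.isProbabilityMeasure_map hm2.aemeasurable
      refine Measure.ext_of_Ici _ _ fun w => ?_
      rw [Measure.map_apply hm1 measurableSet_Ici, Measure.map_apply hm2 measurableSet_Ici]
      change _ = P {ω | w ≤ condProbLE P Y X (y n) ω}
      rw [← hF.2.2 (y n) w, unif01, Measure.restrict_apply (hm1 measurableSet_Ici)]
      congr 1
      ext u
      simp only [mem_inter_iff, mem_preimage, mem_Ici, mem_ofPred_eq]
      constructor
      · rintro ⟨h1, h2⟩; exact ⟨h2, by rwa [← hGF n u h2]⟩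
      · rintro ⟨h1, h2⟩; exact ⟨by rwa [hGF n u h1], h1⟩
    have hint : ∀ n, ∫ u, φ (G n u) ∂unif01
        = ∫ ω, φ ((condDistrib Y X P (X ω)).real (Iic (y n))) ∂P := by
      intro n
      have hm2 : Measurable (condProbLE P Y X (y n)) := measurable_condProb P hX _
      rw [← integral_map (hGa n).measurable.aemeasurable hφ.aestronglyMeasurable, hlaw n,
        integral_map hm2.aemeasurable hφ.aestronglyMeasurable]
      refine integral_congr_ae ?_
      filter_upwards [hκ n] with ω h
      rw [h]
    have hL : Tendsto (fun n => ∫ u, φ (G n u) ∂unif01) atTop (nhds (∫ u, φ (f u) ∂unif01)) := by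
      refine tendsto_integral_of_dominated_convergence (fun _ => C) ?_ (integrable_const C) ?_ ?_
      · exact fun n => (hφ.measurable.comp (hGa n).measurable).aestronglyMeasurable
      · exact fun n => Eventually.of_forall fun u => hC _ (hG0 n u)
      · filter_upwards [hGf] with u hu
        exact (hφ.tendsto _).comp hu
    have hR : Tendsto (fun n => ∫ ω, φ ((condDistrib Y X P (X ω)).real (Iic (y n))) ∂P) atTop
        (nhds (∫ ω, φ ((condDistrib Y X P (X ω)).real (Iio q)) ∂P)) := by
      have hmeas : ∀ s : Set ℝ, MeasurableSet s →
          Measurable fun ω => (condDistrib Y X P (X ω)).real s := fun s hs =>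
        (((condDistrib Y X P).measurable_coe hs).comp hX).ennreal_toReal
      refine tendsto_integral_of_dominated_convergence (fun _ => C) ?_ (integrable_const C) ?_ ?_
      · exact fun n => (hφ.measurable.comp (hmeas _ measurableSet_Iic)).aestronglyMeasurable
      · exact fun n => Eventually.of_forall fun ω => hC _ ⟨measureReal_nonneg, measureReal_le_one⟩
      · refine Eventually.of_forall fun ω => (hφ.tendsto _).comp ?_
        have hU : ⋃ n, Iic (y n) = Iio q := by
          ext z
          simp only [mem_iUnion, mem_Iic, mem_Iio]
          constructor
          · rintro ⟨n, hn⟩; exact hn.trans_lt (hyq n)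
          · intro hz
            exact ((hylim.eventually (eventually_gt_nhds hz)).exists).imp fun n hn => le_of_lt hn
        rw [← hU]
        have := tendsto_measure_iUnion_atTop (μ := condDistrib Y X P (X ω))
          (s := fun n => Iic (y n)) (fun m n hmn => Iic_subset_Iic.2 (hymono.monotone hmn))
        exact (ENNReal.tendsto_toReal (measure_ne_top _ _)).comp this
    simp_rw [hint] at hL
    rw [tendsto_nhds_unique hL hR]
    refine integral_congr_ae ?_
    filter_upwards [hκ'] with ω h
    rw [h]
    have : Iio q = (Ici q)ᶜ := by simp
    rw [this, probReal_compl_eq_one_sub measurableSet_Ici]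
  · intro s
    have h1 : ∀ n, P {ω | qArr F (U ω) (V ω) ≤ y n ∧ U ω ≤ s}
        = ENNReal.ofReal (∫ u in Iic s, G n u ∂unif01) := by
      intro n
      rw [← joint_le P (hGa n) (hG0 n) U V hU hV hUlaw hVlaw hUV s]
      refine measure_congr ?_
      filter_upwards [ae_uv hU hUlaw, ae_uv hV hVlaw] with ω hu hv
      simp only [eq_iff_iff]
      change (qArr F (U ω) (V ω) ≤ y n ∧ U ω ≤ s) ↔ (V ω ≤ G n (U ω) ∧ U ω ≤ s)
      rw [hGF n _ hu, qArr, isCDF_sInf_le (hF.1 _ hu) hv]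
    have hset : {ω | qArr F (U ω) (V ω) < q ∧ U ω ≤ s}
        = ⋃ n, {ω | qArr F (U ω) (V ω) ≤ y n ∧ U ω ≤ s} := by
      ext ω
      simp only [mem_iUnion, mem_ofPred_eq]
      constructor
      · rintro ⟨hz, hs⟩
        exact ((hylim.eventually (eventually_gt_nhds hz)).exists).imp
          fun n hn => ⟨le_of_lt hn, hs⟩
      · rintro ⟨n, hn, hs⟩; exact ⟨hn.trans_lt (hyq n), hs⟩
    have t1 := tendsto_measure_iUnion_atTop (μ := P)
      (s := fun n => {ω | qArr F (U ω) (V ω) ≤ y n ∧ U ω ≤ s})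
      (fun m n hmn ω hω => ⟨hω.1.trans (hymono.monotone hmn), hω.2⟩)
    rw [← hset] at t1
    refine tendsto_nhds_unique t1 ?_
    have : (P ∘ fun n => {ω | qArr F (U ω) (V ω) ≤ y n ∧ U ω ≤ s})
        = fun n => ENNReal.ofReal (∫ u in Iic s, G n u ∂unif01) := funext h1
    rw [this]
    refine (ENNReal.continuous_ofReal.tendsto _).comp ?_
    refine tendsto_integral_of_dominated_convergence (fun _ => 1) ?_ (integrable_const 1) ?_ ?_
    · exact fun n => (hGa n).measurable.aestronglyMeasurable
    · exact fun n => Eventually.of_forall fun u =>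
        abs_le.2 ⟨by linarith [(hG0 n u).1], (hG0 n u).2⟩
    · exact ae_restrict_of_ae hGf

lemma aemeasurable_reduced {Ω β : Type*} [MeasurableSpace Ω] [MeasurableSpace β] (P : Measure Ω)
    [IsProbabilityMeasure P]
    {Y : Ω → ℝ} {X : Ω → β} (hY : Measurable Y)
    {F : ℝ → ℝ → ℝ} (hF : IsRearrangedFamily P Y X F)
    (U V : Ω → ℝ) (hU : Measurable U) (hV : Measurable V)
    (hUlaw : P.map U = unif01) (hVlaw : P.map V = unif01) :
    AEMeasurable (fun ω => cdfRV P Y (qArr F (U ω) (V ω))) P := by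
  classical
  refine (isCDF_cdfRV P hY).1.measurable.comp_aemeasurable ?_
  let D : Set Ω := {ω | U ω ∈ Ioo (0:ℝ) 1 ∧ V ω ∈ Ioo (0:ℝ) 1}
  have hD : MeasurableSet D := (hU measurableSet_Ioo).inter (hV measurableSet_Ioo)
  refine ⟨D.piecewise (fun ω => qArr F (U ω) (V ω)) (fun _ => 0), ?_, ?_⟩
  · refine measurable_of_Iic fun z => ?_
    obtain ⟨g, hga, -, hg⟩ := family_ext hF z
    have : (D.piecewise (fun ω => qArr F (U ω) (V ω)) (fun _ => 0)) ⁻¹' Iic z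
        = D.ite {ω | V ω ≤ g (U ω)} {_ω | (0:ℝ) ≤ z} := by
      rw [piecewise_preimage]
      ext ω
      by_cases hω : ω ∈ D
      · simp only [Set.ite, mem_union, mem_inter_iff, Set.mem_sdiff, hω, mem_preimage, mem_Iic,
          mem_ofPred_eq, and_true, not_true_eq_false, and_false, or_false]
        rw [hg _ hω.1, qArr, isCDF_sInf_le (hF.1 _ hω.1) hω.2]
      · simp [Set.ite, hω]
    rw [this]
    exact hD.ite (measurableSet_le hV (hga.measurable.comp hU)) (MeasurableSet.const _)
  · filter_upwards [ae_uv hU hUlaw, ae_uv hV hVlaw] with ω hu hv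
    rw [piecewise_eq_of_mem]
    exact ⟨hu, hv⟩

lemma unif01_Iic_one_ae : (univ : Set ℝ) =ᵐ[unif01] Iic 1 := by
  filter_upwards [unif01_ae] with u hu
  simp only [eq_iff_iff]
  exact ⟨fun _ => hu.2.le, fun _ => trivial⟩

lemma cxLE_flip {Ω : Type*} [MeasurableSpace Ω] (P : Measure Ω) (S T : Ω → ℝ) :
    CxLE P S P T ↔ ∀ φ : ℝ → ℝ, ConvexOn ℝ Set.univ φ →
      ∫ ω, φ (1 - S ω) ∂P ≤ ∫ ω, φ (1 - T ω) ∂P := by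
  have hflip : ∀ φ : ℝ → ℝ, ConvexOn ℝ Set.univ φ → ConvexOn ℝ Set.univ fun x => φ (1 - x) := by
    intro φ hφ
    refine ⟨convex_univ, fun x _ y _ a b ha hb hab => ?_⟩
    have := hφ.2 (mem_univ (1 - x)) (mem_univ (1 - y)) ha hb hab
    have e : a • (1 - x) + b • (1 - y) = 1 - (a • x + b • y) := by
      simp only [smul_eq_mul]; linear_combination hab
    rwa [e] at this
  constructor
  · intro h φ hφ
    exact h _ (hflip φ hφ)
  · intro h φ hφ
    simpa using h _ (hflip φ hφ)

lemma ccx_iff_strict {Ω β γ : Type*} [MeasurableSpace Ω] [MeasurableSpace β] [MeasurableSpace γ]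
    (P : Measure Ω) [IsProbabilityMeasure P]
    {Y Y' : Ω → ℝ} {X : Ω → β} {X' : Ω → γ} (hY : Measurable Y) (hX : Measurable X)
    (hY' : Measurable Y') (hX' : Measurable X')
    {F F' : ℝ → ℝ → ℝ} (hF : IsRearrangedFamily P Y X F) (hF' : IsRearrangedFamily P Y' X' F')
    (U V : Ω → ℝ) (hU : Measurable U) (hV : Measurable V)
    (hUlaw : P.map U = unif01) (hVlaw : P.map V = unif01)
    (hUV : IndepFun U V P) :
    CCX P Y X P Y' X' ↔ ∀ v ∈ Ioo (0:ℝ) 1,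
      (∀ s : ℝ, P {ω | cdfRV P Y (qArr F (U ω) (V ω)) < v ∧ U ω ≤ s} ≤
        P {ω | cdfRV P Y' (qArr F' (U ω) (V ω)) < v ∧ U ω ≤ s}) ∧
      P {ω | cdfRV P Y (qArr F (U ω) (V ω)) < v ∧ U ω ≤ 1} =
        P {ω | cdfRV P Y' (qArr F' (U ω) (V ω)) < v ∧ U ω ≤ 1} := by
  refine forall₂_congr fun v hv => ?_
  obtain ⟨f, hfa, hf0, hfφ, hfP⟩ := repr_reduced P hY hX hF U V hU hV hUlaw hVlaw hUV
    (quantRV P Y v)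
  obtain ⟨g, hga, hg0, hgφ, hgP⟩ := repr_reduced P hY' hX' hF' U V hU hV hUlaw hVlaw hUV
    (quantRV P Y' v)
  simp_rw [cdfRV_lt_iff P hY hv, cdfRV_lt_iff P hY' hv, hfP, hgP]
  have nn : ∀ {f : ℝ → ℝ}, (∀ u, f u ∈ Icc (0:ℝ) 1) → ∀ s, 0 ≤ ∫ u in Iic s, f u ∂unif01 :=
    fun h s => integral_nonneg fun u => (h u).1
  simp_rw [ENNReal.ofReal_le_ofReal_iff (nn hg0 _)]
  rw [ENNReal.ofReal_eq_ofReal_iff (nn hf0 _) (nn hg0 _),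
    ← setIntegral_congr_set unif01_Iic_one_ae, ← setIntegral_congr_set unif01_Iic_one_ae,
    setIntegral_univ, setIntegral_univ, ← majorization hfa hga hf0 hg0, cxLE_flip]
  refine forall₂_congr fun φ hφ => ?_
  rw [hfφ φ (convex_cont hφ), hgφ φ (convex_cont hφ)]

lemma tendsto_lt {Ω : Type*} [MeasurableSpace Ω] (P : Measure Ω) (T U : Ω → ℝ) (v s : ℝ) :
    Tendsto (fun n : ℕ => P {ω | T ω ≤ v - 1 / ((n : ℝ) + 1) ∧ U ω ≤ s}) atTop
      (nhds (P {ω | T ω < v ∧ U ω ≤ s})) := by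
  have hset : {ω | T ω < v ∧ U ω ≤ s} = ⋃ n : ℕ, {ω | T ω ≤ v - 1 / ((n : ℝ) + 1) ∧ U ω ≤ s} := by
    ext ω
    simp only [mem_iUnion, mem_ofPred_eq]
    constructor
    · rintro ⟨h, hs⟩
      obtain ⟨n, hn⟩ := exists_nat_one_div_lt (sub_pos.2 h)
      exact ⟨n, by linarith, hs⟩
    · rintro ⟨n, hn, hs⟩
      have : (0:ℝ) < 1 / ((n:ℝ) + 1) := by positivity
      exact ⟨by linarith, hs⟩
  rw [hset]
  refine tendsto_measure_iUnion_atTop fun m n hmn ω hω => ⟨hω.1.trans ?_, hω.2⟩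
  have := one_div_le_one_div_of_le (by positivity : (0:ℝ) < (m:ℝ) + 1)
    (by gcongr : (m:ℝ) + 1 ≤ (n:ℝ) + 1)
  linarith

lemma tendsto_le {Ω : Type*} [MeasurableSpace Ω] (P : Measure Ω) [IsProbabilityMeasure P]
    {T U : Ω → ℝ} (hT : AEMeasurable T P) (hU : Measurable U) {t : ℝ} (ht : t < 1) (s : ℝ) :
    Tendsto (fun n : ℕ => P {ω | T ω < t + (1 - t) / ((n : ℝ) + 2) ∧ U ω ≤ s}) atTop
      (nhds (P {ω | T ω ≤ t ∧ U ω ≤ s})) := by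
  have hset : {ω | T ω ≤ t ∧ U ω ≤ s}
      = ⋂ n : ℕ, {ω | T ω < t + (1 - t) / ((n : ℝ) + 2) ∧ U ω ≤ s} := by
    ext ω
    simp only [mem_iInter, mem_ofPred_eq]
    constructor
    · rintro ⟨h, hs⟩ n
      have : (0:ℝ) < (1 - t) / ((n:ℝ) + 2) := div_pos (by linarith) (by positivity)
      exact ⟨by linarith, hs⟩
    · intro h
      refine ⟨?_, (h 0).2⟩
      by_contra hlt
      obtain ⟨n, hn⟩ := exists_nat_gt ((1 - t) / (T ω - t))
      rw [not_le] at hlt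
      rw [div_lt_iff₀ (by linarith)] at hn
      have h1 := (h n).1
      have h2 : T ω - t < (1 - t) / ((n:ℝ) + 2) := by linarith
      rw [lt_div_iff₀ (by positivity)] at h2
      nlinarith
  rw [hset]
  refine tendsto_measure_iInter_atTop (fun n => ?_) (fun m n hmn ω hω => ⟨hω.1.trans_le ?_, hω.2⟩)
    ⟨0, measure_ne_top _ _⟩
  · exact (nullMeasurableSet_lt hT aemeasurable_const).inter
      (measurableSet_le hU measurable_const).nullMeasurableSet
  · have : (0:ℝ) < 1 - t := by linarith
    gcongr

lemma concord_iff_strict {Ω : Type*} [MeasurableSpace Ω]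
    (P : Measure Ω) [IsProbabilityMeasure P] {T T' U : Ω → ℝ}
    (hT : AEMeasurable T P) (hT' : AEMeasurable T' P) (hU : Measurable U)
    (hT0 : ∀ ω, T ω ∈ Icc (0:ℝ) 1) (hT0' : ∀ ω, T' ω ∈ Icc (0:ℝ) 1)
    (hUae : ∀ᵐ ω ∂P, U ω ∈ Ioo (0:ℝ) 1) :
    ConcordLE P T U P T' U ↔ ∀ v ∈ Ioo (0:ℝ) 1,
      (∀ s : ℝ, P {ω | T ω < v ∧ U ω ≤ s} ≤ P {ω | T' ω < v ∧ U ω ≤ s}) ∧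
      P {ω | T ω < v ∧ U ω ≤ 1} = P {ω | T' ω < v ∧ U ω ≤ 1} := by
  have h1ae : ∀ (T : Ω → ℝ) (t : ℝ), P {ω | T ω ≤ t ∧ U ω ≤ 1} = P {ω | T ω ≤ t} := by
    intro T t
    refine measure_congr ?_
    filter_upwards [hUae] with ω hu
    simp only [eq_iff_iff]
    exact ⟨fun h => h.1, fun h => ⟨h, hu.2.le⟩⟩
  constructor
  · intro H v hv
    have hle : ∀ s : ℝ, P {ω | T ω < v ∧ U ω ≤ s} ≤ P {ω | T' ω < v ∧ U ω ≤ s} := fun s =>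
      le_of_tendsto_of_tendsto' (tendsto_lt P T U v s) (tendsto_lt P T' U v s) fun n => (H _ s).1
    refine ⟨hle, le_antisymm (hle 1) ?_⟩
    refine le_of_tendsto_of_tendsto' (tendsto_lt P T' U v 1) (tendsto_lt P T U v 1) fun n => ?_
    set t := v - 1 / ((n:ℝ) + 1)
    rw [h1ae, h1ae]
    have h2 := (H t 0).2
    have h3 : ∀ (T : Ω → ℝ), AEMeasurable T P →
        P {ω | t < T ω ∧ 0 < U ω} = 1 - P {ω | T ω ≤ t} := by
      intro T hT
      rw [← prob_compl_eq_one_sub₀ (nullMeasurableSet_le hT aemeasurable_const)]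
      refine measure_congr ?_
      filter_upwards [hUae] with ω hu
      simp only [eq_iff_iff]
      change (t < T ω ∧ 0 < U ω) ↔ ¬ (T ω ≤ t)
      rw [not_le]
      exact ⟨fun h => h.1, fun h => ⟨h, hu.1⟩⟩
    rw [h3 T hT, h3 T' hT'] at h2
    exact (ENNReal.sub_le_sub_iff_left prob_le_one ENNReal.one_ne_top).1 h2
  · intro H
    have hle : ∀ t s : ℝ, P {ω | T ω ≤ t ∧ U ω ≤ s} ≤ P {ω | T' ω ≤ t ∧ U ω ≤ s} ∧
        P {ω | T ω ≤ t ∧ U ω ≤ 1} = P {ω | T' ω ≤ t ∧ U ω ≤ 1} := by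
      intro t s
      by_cases ht1 : 1 ≤ t
      · have e : ∀ {T : Ω → ℝ}, (∀ ω, T ω ∈ Icc (0:ℝ) 1) → ∀ s,
            {ω | T ω ≤ t ∧ U ω ≤ s} = {ω | U ω ≤ s} := by
          intro T h s; ext ω
          simp only [mem_ofPred_eq]
          exact ⟨fun h => h.2, fun h' => ⟨(h ω).2.trans ht1, h'⟩⟩
        rw [e hT0, e hT0', e hT0, e hT0']
        exact ⟨le_rfl, rfl⟩
      · rw [not_le] at ht1
        by_cases ht0 : t < 0
        · have e : ∀ {T : Ω → ℝ}, (∀ ω, T ω ∈ Icc (0:ℝ) 1) → ∀ s,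
              {ω | T ω ≤ t ∧ U ω ≤ s} = ∅ := by
            intro T h s; ext ω
            simp only [mem_ofPred_eq, mem_empty_iff_false, iff_false]
            exact fun h' => absurd (h ω).1 (by linarith [h'.1])
          rw [e hT0, e hT0', e hT0, e hT0']
          exact ⟨le_rfl, rfl⟩
        · rw [not_lt] at ht0
          have hv : ∀ n : ℕ, t + (1 - t) / ((n : ℝ) + 2) ∈ Ioo (0:ℝ) 1 := by
            intro n
            have hn : (0:ℝ) < (n:ℝ) + 2 := by positivity
            have h1 : (0:ℝ) < (1 - t) / ((n:ℝ) + 2) := div_pos (by linarith) hn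
            have h2 : (1 - t) / ((n:ℝ) + 2) < 1 - t :=
              div_lt_self (by linarith) (by have : (0:ℝ) ≤ n := n.cast_nonneg
                                            linarith)
            exact ⟨by linarith, by linarith⟩
          refine ⟨le_of_tendsto_of_tendsto' (tendsto_le P hT hU ht1 s) (tendsto_le P hT' hU ht1 s)
            fun n => (H _ (hv n)).1 s, ?_⟩
          refine tendsto_nhds_unique (tendsto_le P hT hU ht1 1) ?_
          refine (tendsto_le P hT' hU ht1 1).congr fun n => ((H _ (hv n)).2).symm
    intro t s
    refine ⟨(hle t s).1, ?_⟩
    have key : ∀ (T : Ω → ℝ), AEMeasurable T P →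
        P.real {ω | t < T ω ∧ s < U ω} = 1 - (P.real {ω | T ω ≤ t} + P.real {ω | U ω ≤ s}
          - P.real {ω | T ω ≤ t ∧ U ω ≤ s}) := by
      intro T hT
      have m1 : NullMeasurableSet {ω | T ω ≤ t} P := nullMeasurableSet_le hT aemeasurable_const
      have m2 : MeasurableSet {ω | U ω ≤ s} := measurableSet_le hU measurable_const
      have e1 : {ω | t < T ω ∧ s < U ω} = ({ω | T ω ≤ t} ∪ {ω | U ω ≤ s})ᶜ := by
        ext ω
        simp
      have e2 := measureReal_union_add_inter (μ := P) (s := {ω | T ω ≤ t}) m2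
      have e3 : {ω | T ω ≤ t} ∩ {ω | U ω ≤ s} = {ω | T ω ≤ t ∧ U ω ≤ s} := rfl
      rw [e3] at e2
      have e4 : P.real ({ω | T ω ≤ t} ∪ {ω | U ω ≤ s})ᶜ
          = 1 - P.real ({ω | T ω ≤ t} ∪ {ω | U ω ≤ s}) := by
        rw [measureReal_def, measureReal_def,
          prob_compl_eq_one_sub₀ (m1.union m2.nullMeasurableSet),
          ENNReal.toReal_sub_of_le prob_le_one ENNReal.one_ne_top, ENNReal.toReal_one]
      rw [e1, e4]
      linarith
    have h1 := (hle t s).2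
    rw [h1ae, h1ae] at h1
    have h2 : P.real {ω | T ω ≤ t ∧ U ω ≤ s} ≤ P.real {ω | T' ω ≤ t ∧ U ω ≤ s} :=
      ENNReal.toReal_mono (measure_ne_top _ _) (hle t s).1
    have h3 : P.real {ω | T ω ≤ t} = P.real {ω | T' ω ≤ t} := by
      rw [measureReal_def, h1, measureReal_def]
    have h4 : P.real {ω | t < T ω ∧ s < U ω} ≤ P.real {ω | t < T' ω ∧ s < U ω} := by
      rw [key T hT, key T' hT']
      linarith
    exact (ENNReal.toReal_le_toReal (measure_ne_top _ _) (measure_ne_top _ _)).1 h4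

lemma map_eq_iff_concord {Ω : Type*} [MeasurableSpace Ω]
    (P : Measure Ω) [IsProbabilityMeasure P] {T T' U : Ω → ℝ}
    (hT : AEMeasurable T P) (hT' : AEMeasurable T' P) (hU : Measurable U) :
    P.map (fun ω => (T ω, U ω)) = P.map (fun ω => (T' ω, U ω)) ↔
      (ConcordLE P T U P T' U ∧ ConcordLE P T' U P T U) := by
  have hm : AEMeasurable (fun ω => (T ω, U ω)) P := hT.prodMk hU.aemeasurable
  have hm' : AEMeasurable (fun ω => (T' ω, U ω)) P := hT'.prodMk hU.aemeasurable
  constructor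
  · intro h
    have e1 : ∀ t s : ℝ, P {ω | T ω ≤ t ∧ U ω ≤ s} = P {ω | T' ω ≤ t ∧ U ω ≤ s} := by
      intro t s
      have := congrArg (fun μ => μ (Iic t ×ˢ Iic s)) h
      rwa [Measure.map_apply_of_aemeasurable hm (measurableSet_Iic.prod measurableSet_Iic),
        Measure.map_apply_of_aemeasurable hm' (measurableSet_Iic.prod measurableSet_Iic)] at this
    have e2 : ∀ t s : ℝ, P {ω | t < T ω ∧ s < U ω} = P {ω | t < T' ω ∧ s < U ω} := by
      intro t s
      have := congrArg (fun μ => μ (Ioi t ×ˢ Ioi s)) h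
      rwa [Measure.map_apply_of_aemeasurable hm (measurableSet_Ioi.prod measurableSet_Ioi),
        Measure.map_apply_of_aemeasurable hm' (measurableSet_Ioi.prod measurableSet_Ioi)] at this
    exact ⟨fun t s => ⟨(e1 t s).le, (e2 t s).le⟩, fun t s => ⟨(e1 t s).ge, (e2 t s).ge⟩⟩
  · rintro ⟨h1, h2⟩
    have i1 : IsProbabilityMeasure (P.map (fun ω => (T ω, U ω))) :=
      Measure.isProbabilityMeasure_map hm
    have i2 : IsProbabilityMeasure (P.map (fun ω => (T' ω, U ω))) :=
      Measure.isProbabilityMeasure_map hm'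
    have hspan : IsCountablySpanning (range (Iic : ℝ → Set ℝ)) := by
      refine ⟨fun n : ℕ => Iic (n : ℝ), fun n => ⟨_, rfl⟩, ?_⟩
      ext x
      simp only [mem_iUnion, mem_Iic, mem_univ, iff_true]
      exact exists_nat_ge x
    have hgen : (inferInstance : MeasurableSpace (ℝ × ℝ)) = MeasurableSpace.generateFrom
        (image2 (· ×ˢ ·) (range (Iic : ℝ → Set ℝ)) (range (Iic : ℝ → Set ℝ))) :=
      (generateFrom_eq_prod ((borel_eq_generateFrom_Iic ℝ).symm.trans
          (BorelSpace.measurable_eq (α := ℝ)).symm)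
        ((borel_eq_generateFrom_Iic ℝ).symm.trans
          (BorelSpace.measurable_eq (α := ℝ)).symm) hspan hspan).symm
    refine ext_of_generate_finite _ hgen (isPiSystem_Iic.prod isPiSystem_Iic) ?_ (by simp)
    rintro _ ⟨_, ⟨t, rfl⟩, _, ⟨s, rfl⟩, rfl⟩
    simp only
    rw [Measure.map_apply_of_aemeasurable hm (measurableSet_Iic.prod measurableSet_Iic),
        Measure.map_apply_of_aemeasurable hm' (measurableSet_Iic.prod measurableSet_Iic)]
    exact le_antisymm (h1 t s).1 (h2 t s).1

end Helpers

end CCXPaper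


open CCXPaper in
/-- Characterization of the conditional convex order by the bivariate
concordance order: with `U, V` independent uniform on `(0,1)` and rearranged
conditional distribution families `F, F'` with rearranged quantile transforms
`qArr F, qArr F'`, one has `(Y, X) ⪯ccx (Y', X')` iff
`(F_Y(q^{↑U}_{Y|X}(V)), U) ≤c (F_{Y'}(q^{↑U}_{Y'|X'}(V)), U)`; moreover
`(Y, X) =ccx (Y', X')` iff the two reduced vectors are equal in distribution. -/
theorem ccx_iff_concordance_of_reduced
    {Ω : Type*} [MeasurableSpace Ω] (P : Measure Ω) [IsProbabilityMeasure P]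
    (hPna : Nonatomic P)
    {p p' : ℕ} (Y Y' : Ω → ℝ) (X : Ω → Fin p → ℝ) (X' : Ω → Fin p' → ℝ)
    (hY : Measurable Y) (hX : Measurable X)
    (hY' : Measurable Y') (hX' : Measurable X')
    (F F' : ℝ → ℝ → ℝ)
    (hF : IsRearrangedFamily P Y X F) (hF' : IsRearrangedFamily P Y' X' F')
    (U V : Ω → ℝ) (hU : Measurable U) (hV : Measurable V)
    (hUlaw : P.map U = unif01) (hVlaw : P.map V = unif01)
    (hUV : IndepFun U V P) :
    (CCX P Y X P Y' X' ↔
      ConcordLE P (fun ω => cdfRV P Y (qArr F (U ω) (V ω))) U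
        P (fun ω => cdfRV P Y' (qArr F' (U ω) (V ω))) U) ∧
    (CCXeq P Y X P Y' X' ↔
      P.map (fun ω => (cdfRV P Y (qArr F (U ω) (V ω)), U ω)) =
        P.map (fun ω => (cdfRV P Y' (qArr F' (U ω) (V ω)), U ω))) := by
  have hT := aemeasurable_reduced P hY hF U V hU hV hUlaw hVlaw
  have hT' := aemeasurable_reduced P hY' hF' U V hU hV hUlaw hVlaw
  have hT0 : ∀ ω, cdfRV P Y (qArr F (U ω) (V ω)) ∈ Icc (0:ℝ) 1 := fun ω =>
    isCDF_mem (isCDF_cdfRV P hY) _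
  have hT0' : ∀ ω, cdfRV P Y' (qArr F' (U ω) (V ω)) ∈ Icc (0:ℝ) 1 := fun ω =>
    isCDF_mem (isCDF_cdfRV P hY') _
  have hUae := ae_uv hU hUlaw
  have h1 := (ccx_iff_strict P hY hX hY' hX' hF hF' U V hU hV hUlaw hVlaw hUV).trans
    (concord_iff_strict P hT hT' hU hT0 hT0' hUae).symm
  have h2 := (ccx_iff_strict P hY' hX' hY hX hF' hF U V hU hV hUlaw hVlaw hUV).trans
    (concord_iff_strict P hT' hT hU hT0' hT0 hUae).symm
  exact ⟨h1, (and_congr h1 h2).trans (map_eq_iff_concord P hT hT' hU).symm⟩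
end
end

section
/- Characterization of the conditional convex order by the Schur order (Theorem: characterization of ⪯ccx by the Schur order). Let (Y,X) and (Y',X') be random vectors with X ℝ^p-valued and X' ℝ^{p'}-valued, and for each v ∈ (0,1) let η^v : (0,1)^p → [0,1] and η'^v : (0,1)^{p'} → [0,1] be Borel functions such that the pushforward of Lebesgue measure λ^p on (0,1)^p under η^v equals the law of P(Y ≤ q_Y(v) | X), and the pushforward of λ^{p'} under η'^v equals the law of P(Y' ≤ q_{Y'}(v) | X'). Then the following are equivalent: (i) (Y,X) ⪯ccx (Y',X'); (ii) η^v ≺_S η'^v for Lebesgue-almost all v ∈ (0,1). -/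
open MeasureTheory ProbabilityTheory Set Filter

noncomputable section

namespace CCXPaper
section helpers
variable {Ω : Type*} [MeasurableSpace Ω] {P : Measure Ω} [IsProbabilityMeasure P]

lemma cdfRV_eq {Y : Ω → ℝ} (hY : Measurable Y) (y : ℝ) : cdfRV P Y y = cdf (P.map Y) y := by
  have : IsProbabilityMeasure (P.map Y) := Measure.isProbabilityMeasure_map hY.aemeasurable
  rw [cdf_eq_real, map_measureReal_apply hY measurableSet_Iic]
  rfl

lemma quant_le_iff {Y : Ω → ℝ} (hY : Measurable Y) {v : ℝ} (hv : v ∈ Ioo (0:ℝ) 1) (y : ℝ) :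
    quantRV P Y v ≤ y ↔ v ≤ cdfRV P Y y := by
  have hp : IsProbabilityMeasure (P.map Y) := Measure.isProbabilityMeasure_map hY.aemeasurable
  have e : {y : ℝ | v ≤ cdfRV P Y y} = {y : ℝ | v ≤ cdf (P.map Y) y} := by
    ext y; simp [cdfRV_eq hY]
  unfold quantRV
  rw [e, cdfRV_eq hY]
  set S := {y : ℝ | v ≤ cdf (P.map Y) y} with hS
  have hne : S.Nonempty := by
    obtain ⟨y, h⟩ := ((tendsto_cdf_atTop (P.map Y)).eventually (eventually_ge_nhds hv.2)).exists
    exact ⟨y, h⟩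
  have hbd : BddBelow S := by
    obtain ⟨y, h⟩ := ((tendsto_cdf_atBot (P.map Y)).eventually (eventually_lt_nhds hv.1)).exists
    refine ⟨y, fun z hz => ?_⟩
    by_contra hlt
    push Not at hlt
    exact absurd (lt_of_le_of_lt (monotone_cdf (P.map Y) hlt.le) h) (not_lt.2 hz)
  have hmem : sInf S ∈ S := by
    have hc := (cdf (P.map Y)).right_continuous (sInf S)
    have hc' : Tendsto (cdf (P.map Y)) (nhdsWithin (sInf S) (Ioi (sInf S)))
        (nhds (cdf (P.map Y) (sInf S))) := hc.mono_left (nhdsWithin_mono _ Ioi_subset_Ici_self)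
    refine ge_of_tendsto hc' ?_
    filter_upwards [self_mem_nhdsWithin] with z hz
    obtain ⟨s, hs, hsz⟩ := exists_lt_of_csInf_lt hne hz
    exact le_trans hs (monotone_cdf (P.map Y) hsz.le)
  constructor
  · intro h
    exact le_trans hmem (monotone_cdf (P.map Y) h)
  · intro h
    exact csInf_le hbd h

lemma cdf_lt_of_lt_quant {Y : Ω → ℝ} (hY : Measurable Y) {v : ℝ} (hv : v ∈ Ioo (0:ℝ) 1) {y : ℝ}
    (h : y < quantRV P Y v) : cdfRV P Y y < v := by
  by_contra hh
  push Not at hh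
  exact absurd ((quant_le_iff hY hv y).2 hh) (not_le.2 h)

lemma le_cdf_quant {Y : Ω → ℝ} (hY : Measurable Y) {v : ℝ} (hv : v ∈ Ioo (0:ℝ) 1) :
    v ≤ cdfRV P Y (quantRV P Y v) := (quant_le_iff hY hv _).1 le_rfl

lemma cdf_mono {Y : Ω → ℝ} : Monotone (cdfRV P Y) := by
  intro a b hab
  exact measureReal_mono (μ := P) (fun ω (h : Y ω ≤ a) => h.trans hab)

lemma quant_mono {Y : Ω → ℝ} (hY : Measurable Y) : MonotoneOn (quantRV P Y) (Ioo 0 1) := by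
  intro a ha b hb hab
  exact (quant_le_iff hY ha _).2 (hab.trans (le_cdf_quant hY hb))

/-- `F(q(v)-)`. -/
def GG (P : Measure Ω) (Y : Ω → ℝ) (v : ℝ) : ℝ := P.real {ω | Y ω < quantRV P Y v}

/-- `F(q(v))`. -/
def HH (P : Measure Ω) (Y : Ω → ℝ) (v : ℝ) : ℝ := cdfRV P Y (quantRV P Y v)

lemma GG_le {Y : Ω → ℝ} (hY : Measurable Y) {v : ℝ} (hv : v ∈ Ioo (0:ℝ) 1) : GG P Y v ≤ v := by
  set q := quantRV P Y v with hq
  obtain ⟨u, hu, hlt, hlim⟩ := exists_seq_strictMono_tendsto q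
  have hU : {ω | Y ω < q} = ⋃ n, {ω | Y ω ≤ u n} := by
    ext ω
    simp only [mem_ofPred_eq, mem_iUnion]
    constructor
    · intro h
      obtain ⟨n, hn⟩ := (hlim.eventually (eventually_gt_nhds h)).exists
      exact ⟨n, hn.le⟩
    · rintro ⟨n, hn⟩
      exact hn.trans_lt (hlt n)
  have ht := tendsto_measure_iUnion_atTop (μ := P) (s := fun n => {ω | Y ω ≤ u n})
    (fun a b hab ω (h : Y ω ≤ u a) => h.trans (hu.monotone hab))
  rw [← hU] at ht
  have ht2 := (ENNReal.tendsto_toReal (measure_ne_top P {ω | Y ω < q})).comp ht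
  refine le_of_tendsto ht2 (Eventually.of_forall fun n => ?_)
  exact (cdf_lt_of_lt_quant hY hv (hlt n)).le

lemma le_HH {Y : Ω → ℝ} (hY : Measurable Y) {v : ℝ} (hv : v ∈ Ioo (0:ℝ) 1) : v ≤ HH P Y v :=
  le_cdf_quant hY hv

lemma HH_mono {Y : Ω → ℝ} (hY : Measurable Y) : MonotoneOn (HH P Y) (Ioo 0 1) :=
  fun _ ha _ hb hab => cdf_mono (quant_mono hY ha hb hab)

lemma quant_lt_of_lt_GG {Y : Ω → ℝ} (hY : Measurable Y) {v w : ℝ} (hv : v ∈ Ioo (0:ℝ) 1)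
    (hw : w ∈ Ioo (0:ℝ) 1) (h : w < GG P Y v) : quantRV P Y w < quantRV P Y v := by
  by_contra hh
  push Not at hh
  have h1 : GG P Y v ≤ GG P Y w :=
    measureReal_mono (μ := P) (fun ω (h : Y ω < _) => h.trans_le hh)
  linarith [GG_le (P := P) hY hw]

lemma HH_le_GG {Y : Ω → ℝ} {v w : ℝ} (h : quantRV P Y w < quantRV P Y v) :
    HH P Y w ≤ GG P Y v :=
  measureReal_mono (μ := P) (fun ω (h' : Y ω ≤ _) => h'.trans_lt h)

lemma quant_lt_of_HH_lt {Y : Ω → ℝ} (hY : Measurable Y) {v w : ℝ} 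
    (hw : w ∈ Ioo (0:ℝ) 1) (h : HH P Y v < w) : quantRV P Y v < quantRV P Y w := by
  by_contra hh
  push Not at hh
  have := (quant_le_iff hY hw _).1 hh
  exact absurd h (not_lt.2 this)

/-- `v ≤ w ≤ H(v)` gives equal quantiles -/
lemma quant_eq {Y : Ω → ℝ} (hY : Measurable Y) {v w : ℝ} (hv : v ∈ Ioo (0:ℝ) 1)
    (hw : w ∈ Ioo (0:ℝ) 1) (h1 : v ≤ w) (h2 : w ≤ HH P Y v) : quantRV P Y w = quantRV P Y v :=
  le_antisymm ((quant_le_iff hY hw _).2 h2) (quant_mono hY hv hw h1)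

lemma HH_le_of_GG_eq {Y Y' : Ω → ℝ} (hY : Measurable Y) (hY' : Measurable Y')
    (hG : ∀ v ∈ Ioo (0:ℝ) 1, GG P Y v = GG P Y' v) {v : ℝ} (hv : v ∈ Ioo (0:ℝ) 1)
    (hc : ContinuousWithinAt (HH P Y') (Ioo 0 1) v) : HH P Y v ≤ HH P Y' v := by
  by_contra hh
  push Not at hh
  have hH1 : HH P Y v ≤ 1 := measureReal_le_one
  have hvH : v < HH P Y v := (le_HH hY' hv).trans_lt hh
  have hc1 : ContinuousAt (HH P Y') v := hc.continuousAt (Ioo_mem_nhds hv.1 hv.2)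
  have ev : ∀ᶠ z in nhdsWithin v (Ioi v), HH P Y' z < HH P Y v ∧ z < HH P Y v ∧ z > v := by
    filter_upwards [nhdsWithin_le_nhds (hc1.eventually (eventually_lt_nhds hh)),
      nhdsWithin_le_nhds (eventually_lt_nhds hvH), self_mem_nhdsWithin] with z a b c
    exact ⟨a, b, c⟩
  obtain ⟨z, hz1, hz2, hz3⟩ := ev.exists
  have hz : z ∈ Ioo (0:ℝ) 1 := ⟨hv.1.trans hz3, hz2.trans_le hH1⟩
  obtain ⟨w, hw1, hw2⟩ := exists_between hz1
  have hzH := le_HH (P := P) hY' hz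
  have hw : w ∈ Ioo (0:ℝ) 1 := ⟨by linarith [hz.1], by linarith⟩
  have h1 := HH_le_GG (quant_lt_of_HH_lt hY' hw hw1)
  have h2 := quant_eq hY hv hw (by linarith) hw2.le
  have h3 : GG P Y w = GG P Y v := by unfold GG; rw [h2]
  have h4 := GG_le (P := P) hY hv
  have h5 := hG w hw
  linarith

lemma HH_ae_eq {Y Y' : Ω → ℝ} (hY : Measurable Y) (hY' : Measurable Y')
    (hG : ∀ v ∈ Ioo (0:ℝ) 1, GG P Y v = GG P Y' v) :
    ∀ᵐ v ∂unif01, HH P Y v = HH P Y' v := by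
  have c1 := (HH_mono (P := P) hY).countable_not_continuousWithinAt
  have c2 := (HH_mono (P := P) hY').countable_not_continuousWithinAt
  have n1 : ∀ᵐ v ∂unif01, v ∉ {x ∈ Ioo (0:ℝ) 1 | ¬ContinuousWithinAt (HH P Y) (Ioo 0 1) x} :=
    ae_restrict_of_ae (c1.ae_notMem volume)
  have n2 : ∀ᵐ v ∂unif01, v ∉ {x ∈ Ioo (0:ℝ) 1 | ¬ContinuousWithinAt (HH P Y') (Ioo 0 1) x} :=
    ae_restrict_of_ae (c2.ae_notMem volume)
  have n3 : ∀ᵐ v ∂unif01, v ∈ Ioo (0:ℝ) 1 := ae_restrict_mem measurableSet_Ioo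
  filter_upwards [n1, n2, n3] with v a b hv
  simp only [not_and, not_not] at a b
  exact le_antisymm (HH_le_of_GG_eq hY hY' hG hv (b hv))
    (HH_le_of_GG_eq hY' hY (fun v hv => (hG v hv).symm) hv (a hv))

lemma exists_good {p : ℝ → Prop} (h : ∀ᵐ v ∂unif01, p v) {a b : ℝ} (ha : 0 ≤ a) (hab : a < b)
    (hb : b ≤ 1) : ∃ w, a < w ∧ w < b ∧ p w := by
  have h' : ∀ᵐ v ∂(volume.restrict (Ioo a b)), p v :=
    ae_mono (Measure.restrict_mono (Ioo_subset_Ioo ha hb) le_rfl) h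
  have hm : ∀ᵐ v ∂(volume.restrict (Ioo a b)), v ∈ Ioo a b := ae_restrict_mem measurableSet_Ioo
  have hne : (volume.restrict (Ioo a b)) ≠ 0 := by
    intro h0
    have := Measure.restrict_eq_zero.1 h0
    simp at this
    linarith
  have : (ae (volume.restrict (Ioo a b))).NeBot := ae_neBot.2 hne
  obtain ⟨w, h1, h2⟩ := (h'.and hm).exists
  exact ⟨w, h2.1, h2.2, h1⟩

lemma GG_le_of_HH_eq {Y Y' : Ω → ℝ} (hY : Measurable Y) (hY' : Measurable Y')
    (hH : ∀ᵐ v ∂unif01, HH P Y v = HH P Y' v) {v : ℝ} (hv : v ∈ Ioo (0:ℝ) 1) :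
    GG P Y' v ≤ GG P Y v := by
  by_contra hh
  push Not at hh
  have h2 := GG_le (P := P) hY' hv
  have h0 : 0 ≤ GG P Y v := measureReal_nonneg
  obtain ⟨w, hw1, hw2, hw3⟩ := exists_good hH h0 hh (h2.trans hv.2.le)
  have hw : w ∈ Ioo (0:ℝ) 1 := ⟨by linarith, by linarith [hv.2]⟩
  have hq' := quant_lt_of_lt_GG hY' hv hw hw2
  have hH' := HH_le_GG hq'
  have hqq : quantRV P Y v ≤ quantRV P Y w := by
    by_contra hlt
    push Not at hlt
    have := HH_le_GG hlt
    have := le_HH (P := P) hY hw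
    linarith
  have h3 : v ≤ HH P Y w := (quant_le_iff hY hv _).1 hqq
  have h4 : quantRV P Y' v ≤ quantRV P Y' w := (quant_le_iff hY' hv _).2 (h3.trans hw3.le)
  linarith

end helpers
section convexity

lemma cvx_cont {φ : ℝ → ℝ} (hφ : ConvexOn ℝ univ φ) : Continuous φ :=
  continuousOn_univ.1 (hφ.continuousOn isOpen_univ)

lemma cvx_subgrad {φ : ℝ → ℝ} (hφ : ConvexOn ℝ univ φ) :
    ∃ d : ℝ → ℝ, Monotone d ∧ ∀ x y, φ x + d x * (y - x) ≤ φ y := by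
  refine ⟨fun x => derivWithin φ (Ioi x) x, ?_, ?_⟩
  · have := hφ.monotoneOn_rightDeriv
    rw [interior_univ] at this
    exact monotoneOn_univ.1 this
  · intro x y
    have hx : x ∈ interior (univ : Set ℝ) := by simp
    rcases lt_trichotomy x y with h | h | h
    · have := hφ.rightDeriv_le_slope_of_mem_interior hx (mem_univ y) h
      rw [slope_def_field, le_div_iff₀ (by linarith)] at this
      linarith
    · simp [h]
    · have h1 := hφ.slope_le_leftDeriv_of_mem_interior (mem_univ y) hx h
      have h2 := hφ.leftDeriv_le_rightDeriv_of_mem_interior hx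
      have := h1.trans h2
      rw [slope_def_field, div_le_iff₀ (by linarith)] at this
      linarith

lemma cvx_lip {φ : ℝ → ℝ} (hφ : ConvexOn ℝ univ φ) :
    ∃ L : ℝ, 0 ≤ L ∧ ∀ x ∈ Icc (0:ℝ) 1, ∀ y ∈ Icc (0:ℝ) 1, |φ x - φ y| ≤ L * |x - y| := by
  obtain ⟨d, hd, hs⟩ := cvx_subgrad hφ
  have key : ∀ x ∈ Icc (0:ℝ) 1, ∀ y, φ x - φ y ≤ (|d 0| + |d 1|) * |x - y| := by
    intro x hx y
    have h1 := hs x y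
    have h2 : |d x| ≤ |d 0| + |d 1| := by
      rw [abs_le]
      have a := hd hx.1
      have b := hd hx.2
      constructor
      · linarith [neg_abs_le (d 0), abs_nonneg (d 1)]
      · linarith [le_abs_self (d 1), abs_nonneg (d 0)]
    calc φ x - φ y ≤ d x * (x - y) := by linarith
      _ ≤ |d x * (x - y)| := le_abs_self _
      _ = |d x| * |x - y| := abs_mul _ _
      _ ≤ _ := by gcongr
  refine ⟨|d 0| + |d 1|, by positivity, fun x hx y hy => ?_⟩
  rw [abs_le]
  have a := key x hx y
  have b := key y hy x
  rw [abs_sub_comm y x] at b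
  constructor <;> linarith

lemma cvx_integrable {α : Type*} [MeasurableSpace α] {μ : Measure α} [IsFiniteMeasure μ]
    {φ : ℝ → ℝ} (hφ : Continuous φ) {S : α → ℝ} (hS : AEStronglyMeasurable S μ)
    (hb : ∀ᵐ a ∂μ, S a ∈ Icc (0:ℝ) 1) : Integrable (fun a => φ (S a)) μ := by
  obtain ⟨C, hC⟩ := isCompact_Icc.exists_bound_of_continuousOn (hφ.continuousOn (s := Icc (0:ℝ) 1))
  refine Integrable.of_bound (hφ.comp_aestronglyMeasurable hS) C ?_
  filter_upwards [hb] with a ha using hC _ ha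

end convexity

section hlp

lemma setInt_eq (F : ℝ → ℝ) {x : ℝ} (hx : x ≤ 1) :
    ∫ t in Ioo (0:ℝ) x, F t = ∫ t, (Iio x).indicator F t ∂unif01 := by
  rw [integral_indicator measurableSet_Iio, unif01, Measure.restrict_restrict measurableSet_Iio]
  congr 2
  ext t
  simp only [mem_Ioo, mem_inter_iff, mem_Iio]
  constructor
  · rintro ⟨a, b⟩; exact ⟨b, a, b.trans_le hx⟩
  · rintro ⟨a, b, c⟩; exact ⟨b, a⟩

lemma anti_aem {f : ℝ → ℝ} (hf : AntitoneOn f (Ioo 0 1)) : AEMeasurable f unif01 :=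
  aemeasurable_restrict_of_antitoneOn measurableSet_Ioo hf

lemma ae_Ioo : ∀ᵐ t ∂unif01, t ∈ Ioo (0:ℝ) 1 := ae_restrict_mem measurableSet_Ioo

lemma ae_ne (x : ℝ) : ∀ᵐ t ∂unif01, t ≠ x :=
  ae_restrict_of_ae (by simp [ae_iff])

lemma anti_int_level {h k : ℝ → ℝ} (hh : AntitoneOn h (Ioo 0 1)) 
    (hpos : ∀ x ∈ Ioo (0:ℝ) 1, 0 ≤ ∫ t in Ioo (0:ℝ) x, k t)
    (h0 : ∫ t in Ioo (0:ℝ) 1, k t = 0) (s : ℝ) :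
    0 ≤ ∫ t, {t | s ≤ h t}.indicator k t ∂unif01 := by
  set A := {t ∈ Ioo (0:ℝ) 1 | s ≤ h t} with hA
  by_cases hne : A.Nonempty
  · have hbd : BddAbove A := ⟨1, fun t ht => ht.1.2.le⟩
    set x := sSup A with hx
    have hx1 : x ≤ 1 := csSup_le hne fun t ht => ht.1.2.le
    have hx0 : 0 < x := by
      obtain ⟨t, ht⟩ := hne
      exact ht.1.1.trans_le (le_csSup hbd ht)
    have he : ∫ t, {t | s ≤ h t}.indicator k t ∂unif01 = ∫ t in Ioo (0:ℝ) x, k t := by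
      rw [setInt_eq k hx1]
      apply integral_congr_ae
      filter_upwards [ae_Ioo, ae_ne x] with t ht htx
      rcases lt_or_gt_of_ne htx with hlt | hgt
      · obtain ⟨a, ha, hta⟩ := exists_lt_of_lt_csSup hne hlt
        have : s ≤ h t := ha.2.trans (hh ht ha.1 hta.le)
        rw [indicator_of_mem (show t ∈ {t | s ≤ h t} from this), indicator_of_mem (show t ∈ Iio x from hlt)]
      · have : ¬ s ≤ h t := fun hst => absurd (le_csSup hbd (show t ∈ A from ⟨ht, hst⟩)) (not_le.2 hgt)
        rw [indicator_of_notMem (show t ∉ {t | s ≤ h t} from this),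
          indicator_of_notMem (show t ∉ Iio x from not_lt.2 hgt.le)]
    rw [he]
    rcases hx1.lt_or_eq with h1 | h1
    · exact hpos x ⟨hx0, h1⟩
    · rw [h1, h0]
  · have : ∫ t, {t | s ≤ h t}.indicator k t ∂unif01 = 0 := by
      apply integral_eq_zero_of_ae
      filter_upwards [ae_Ioo] with t ht
      apply indicator_of_notMem
      intro hst
      exact hne ⟨t, ht, hst⟩
    rw [this]

lemma anti_int {h k : ℝ → ℝ} (hh : AntitoneOn h (Ioo 0 1)) {m M : ℝ}
    (hm : ∀ t ∈ Ioo (0:ℝ) 1, m ≤ h t) (hM : ∀ t ∈ Ioo (0:ℝ) 1, h t ≤ M)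
    (hk : Integrable k unif01)
    (hpos : ∀ x ∈ Ioo (0:ℝ) 1, 0 ≤ ∫ t in Ioo (0:ℝ) x, k t)
    (h0 : ∫ t in Ioo (0:ℝ) 1, k t = 0) :
    0 ≤ ∫ t, h t * k t ∂unif01 := by
  set ν : Measure ℝ := volume.restrict (Ioc m M) with hν
  have hnull : NullMeasurableSet {z : ℝ × ℝ | z.2 ≤ h z.1} (unif01.prod ν) :=
    nullMeasurableSet_le measurable_snd.aemeasurable (anti_aem hh).comp_fst
  have hint : Integrable (Function.uncurry fun t s => {t | s ≤ h t}.indicator k t)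
      (unif01.prod ν) := by
    have h1 : Integrable (fun z : ℝ × ℝ => k z.1) (unif01.prod ν) := hk.comp_fst ν
    exact h1.indicator₀ hnull
  have hswap := integral_integral_swap hint
  have hpt : ∀ t ∈ Ioo (0:ℝ) 1, ∫ s, {t | s ≤ h t}.indicator k t ∂ν = (h t - m) * k t := by
    intro t ht
    have e1 : (fun s => {t | s ≤ h t}.indicator k t) = (Iic (h t)).indicator (fun _ => k t) := by
      ext s
      simp [indicator]
    rw [e1, integral_indicator measurableSet_Iic, hν, Measure.restrict_restrict measurableSet_Iic]
    have e2 : Iic (h t) ∩ Ioc m M = Ioc m (h t) := by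
      ext s
      simp only [mem_inter_iff, mem_Iic, mem_Ioc]
      constructor
      · rintro ⟨a, b, c⟩; exact ⟨b, a⟩
      · rintro ⟨a, b⟩; exact ⟨b, a, b.trans (hM t ht)⟩
    rw [e2]
    simp [Measure.real, Real.volume_Ioc, hm t ht]
  have e3 : ∫ t, ∫ s, {t | s ≤ h t}.indicator k t ∂ν ∂unif01 = ∫ t, (h t - m) * k t ∂unif01 := by
    apply integral_congr_ae
    filter_upwards [ae_Ioo] with t ht using hpt t ht
  have hnn : 0 ≤ ∫ t, (h t - m) * k t ∂unif01 := by
    rw [← e3, hswap]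
    exact integral_nonneg fun s => anti_int_level hh hpos h0 s
  have hhk : Integrable (fun t => h t * k t) unif01 := by
    refine hk.bdd_mul (c := |m| + |M|) (anti_aem hh).aestronglyMeasurable ?_
    filter_upwards [ae_Ioo] with t ht
    rw [Real.norm_eq_abs, abs_le]
    have a := hm t ht
    have b := hM t ht
    constructor
    · linarith [neg_abs_le m, abs_nonneg M]
    · linarith [le_abs_self M, abs_nonneg m]
  have e4 : ∫ t, (h t - m) * k t ∂unif01 = ∫ t, h t * k t ∂unif01 - m * ∫ t, k t ∂unif01 := by
    rw [← integral_const_mul, ← integral_sub hhk (hk.const_mul m)]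
    congr 1
    ext t
    ring
  have h0' : ∫ t, k t ∂unif01 = 0 := h0
  rw [e4, h0'] at hnn
  linarith

lemma hlp_forward0 {f g : ℝ → ℝ} (hf : AntitoneOn f (Ioo 0 1)) (hg : AntitoneOn g (Ioo 0 1))
    (hf1 : ∀ t, f t ∈ Icc (0:ℝ) 1) (hg1 : ∀ t, g t ∈ Icc (0:ℝ) 1)
    (hpos : ∀ x ∈ Ioo (0:ℝ) 1, (∫ t in Ioo (0:ℝ) x, f t) ≤ ∫ t in Ioo (0:ℝ) x, g t)
    (h0 : ∫ t in Ioo (0:ℝ) 1, f t = ∫ t in Ioo (0:ℝ) 1, g t)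
    {φ : ℝ → ℝ} (hφ : ConvexOn ℝ univ φ) :
    ∫ t, φ (f t) ∂unif01 ≤ ∫ t, φ (g t) ∂unif01 := by
  obtain ⟨d, hd, hs⟩ := cvx_subgrad hφ
  have fi : Integrable f unif01 := cvx_integrable continuous_id (anti_aem hf).aestronglyMeasurable
    (Eventually.of_forall hf1)
  have gi : Integrable g unif01 := cvx_integrable continuous_id (anti_aem hg).aestronglyMeasurable
    (Eventually.of_forall hg1)
  have fφ : Integrable (fun t => φ (f t)) unif01 :=
    cvx_integrable (cvx_cont hφ) (anti_aem hf).aestronglyMeasurable (Eventually.of_forall hf1)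
  have gφ : Integrable (fun t => φ (g t)) unif01 :=
    cvx_integrable (cvx_cont hφ) (anti_aem hg).aestronglyMeasurable (Eventually.of_forall hg1)
  have hdf : AntitoneOn (fun t => d (f t)) (Ioo 0 1) := fun a ha b hb hab => hd (hf ha hb hab)
  have sub : ∀ x ≤ (1:ℝ), ∫ t in Ioo (0:ℝ) x, (g t - f t) =
      (∫ t in Ioo (0:ℝ) x, g t) - ∫ t in Ioo (0:ℝ) x, f t := by
    intro x hx
    have hle : volume.restrict (Ioo 0 x) ≤ unif01 :=
      Measure.restrict_mono (Ioo_subset_Ioo le_rfl hx) le_rfl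
    exact integral_sub (gi.mono_measure hle) (fi.mono_measure hle)
  have key := anti_int hdf (m := d 0) (M := d 1) (fun t _ => hd (hf1 t).1) (fun t _ => hd (hf1 t).2)
    (gi.sub fi) (fun x hx => by have := hpos x hx; have := sub x hx.2.le; simp only [Pi.sub_apply]; linarith)
    (by have := sub 1 le_rfl; simp only [Pi.sub_apply]; linarith)
  have hki : Integrable (fun t => d (f t) * (g - f) t) unif01 := by
    refine (gi.sub fi).bdd_mul (c := |d 0| + |d 1|) (anti_aem hdf).aestronglyMeasurable ?_
    filter_upwards with t
    rw [Real.norm_eq_abs, abs_le]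
    have a := hd (hf1 t).1
    have b := hd (hf1 t).2
    constructor
    · linarith [neg_abs_le (d 0), abs_nonneg (d 1)]
    · linarith [le_abs_self (d 1), abs_nonneg (d 0)]
  have : ∫ t, φ (f t) ∂unif01 + ∫ t, d (f t) * (g - f) t ∂unif01 ≤ ∫ t, φ (g t) ∂unif01 := by
    rw [← integral_add fφ hki]
    exact integral_mono (fφ.add hki) gφ fun t => hs (f t) (g t)
  linarith

/-- clamp to the unit interval -/
def clamp (x : ℝ) : ℝ := max 0 (min 1 x)

lemma clamp_mono : Monotone clamp := fun _ _ h => max_le_max le_rfl (min_le_min le_rfl h)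
lemma clamp_mem (x : ℝ) : clamp x ∈ Icc (0:ℝ) 1 :=
  ⟨le_max_left _ _, max_le zero_le_one (min_le_left _ _)⟩
lemma clamp_eq {x : ℝ} (h : x ∈ Icc (0:ℝ) 1) : clamp x = x := by
  simp [clamp, h.1, h.2]

lemma hlp_forward {f g : ℝ → ℝ} (hf : AntitoneOn f (Ioo 0 1)) (hg : AntitoneOn g (Ioo 0 1))
    (hf1 : ∀ᵐ t ∂unif01, f t ∈ Icc (0:ℝ) 1) (hg1 : ∀ᵐ t ∂unif01, g t ∈ Icc (0:ℝ) 1)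
    (hpos : ∀ x ∈ Ioo (0:ℝ) 1, (∫ t in Ioo (0:ℝ) x, f t) ≤ ∫ t in Ioo (0:ℝ) x, g t)
    (h0 : ∫ t in Ioo (0:ℝ) 1, f t = ∫ t in Ioo (0:ℝ) 1, g t)
    {φ : ℝ → ℝ} (hφ : ConvexOn ℝ univ φ) :
    ∫ t, φ (f t) ∂unif01 ≤ ∫ t, φ (g t) ∂unif01 := by
  have cl : ∀ {f : ℝ → ℝ}, (∀ᵐ t ∂unif01, f t ∈ Icc (0:ℝ) 1) → ∀ x ≤ (1:ℝ),
      ∫ t in Ioo (0:ℝ) x, clamp (f t) = ∫ t in Ioo (0:ℝ) x, f t := by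
    intro f hf x hx
    have hle : volume.restrict (Ioo 0 x) ≤ unif01 :=
      Measure.restrict_mono (Ioo_subset_Ioo le_rfl hx) le_rfl
    apply integral_congr_ae
    filter_upwards [ae_mono hle hf] with t ht using clamp_eq ht
  have cl2 : ∀ {f : ℝ → ℝ}, (∀ᵐ t ∂unif01, f t ∈ Icc (0:ℝ) 1) →
      ∫ t, φ (clamp (f t)) ∂unif01 = ∫ t, φ (f t) ∂unif01 := by
    intro f hf
    apply integral_congr_ae
    filter_upwards [hf] with t ht
    rw [clamp_eq ht]
  rw [← cl2 hf1, ← cl2 hg1]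
  apply hlp_forward0 (f := fun t => clamp (f t)) (g := fun t => clamp (g t))
    (fun a ha b hb hab => clamp_mono (hf ha hb hab)) (fun a ha b hb hab => clamp_mono (hg ha hb hab))
    (fun t => clamp_mem _) (fun t => clamp_mem _) _ _ hφ
  · intro x hx
    rw [cl hf1 x hx.2.le, cl hg1 x hx.2.le]
    exact hpos x hx
  · rw [cl hf1 1 le_rfl, cl hg1 1 le_rfl, h0]

lemma hlp_backward {f g : ℝ → ℝ} (hf : AntitoneOn f (Ioo 0 1)) (hg : AntitoneOn g (Ioo 0 1))
    (hf1 : ∀ᵐ t ∂unif01, f t ∈ Icc (0:ℝ) 1) (hg1 : ∀ᵐ t ∂unif01, g t ∈ Icc (0:ℝ) 1)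
    (hcx : ∀ φ : ℝ → ℝ, ConvexOn ℝ univ φ → ∫ t, φ (f t) ∂unif01 ≤ ∫ t, φ (g t) ∂unif01) :
    (∀ x ∈ Ioo (0:ℝ) 1, (∫ t in Ioo (0:ℝ) x, f t) ≤ ∫ t in Ioo (0:ℝ) x, g t) ∧
    ∫ t in Ioo (0:ℝ) 1, f t = ∫ t in Ioo (0:ℝ) 1, g t := by
  have fi : Integrable f unif01 := cvx_integrable continuous_id (anti_aem hf).aestronglyMeasurable hf1
  have gi : Integrable g unif01 := cvx_integrable continuous_id (anti_aem hg).aestronglyMeasurable hg1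
  constructor
  · intro x hx
    set c := g x with hc
    have hle : volume.restrict (Ioo 0 x) ≤ unif01 :=
      Measure.restrict_mono (Ioo_subset_Ioo le_rfl hx.2.le) le_rfl
    have hφ : ConvexOn ℝ univ (fun y : ℝ => max (y - c) 0) := by
      have h1 : ConvexOn ℝ univ (fun y : ℝ => y - c) :=
        (convexOn_id convex_univ).sub (concaveOn_const c convex_univ)
      exact h1.sup (convexOn_const 0 convex_univ)
    have h := hcx _ hφ
    have sub : ∀ {F : ℝ → ℝ}, Integrable F unif01 → ∫ t in Ioo (0:ℝ) x, (F t - c) =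
        (∫ t in Ioo (0:ℝ) x, F t) - x * c := by
      intro F hF
      rw [integral_sub (hF.mono_measure hle) (integrable_const c)]
      simp [Measure.real, Real.volume_Ioo, hx.1.le]
    have e1 : ∫ t in Ioo (0:ℝ) x, (f t - c) ≤ ∫ t, max (f t - c) 0 ∂unif01 := by
      rw [setInt_eq _ hx.2.le]
      apply integral_mono
      · exact (fi.sub (integrable_const c)).indicator measurableSet_Iio
      · exact cvx_integrable (cvx_cont hφ) (anti_aem hf).aestronglyMeasurable hf1
      · intro t
        by_cases ht : t ∈ Iio x
        · simp [indicator_of_mem ht]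
        · simp [indicator_of_notMem ht]
    have e2 : ∫ t in Ioo (0:ℝ) x, (g t - c) = ∫ t, max (g t - c) 0 ∂unif01 := by
      rw [setInt_eq _ hx.2.le]
      apply integral_congr_ae
      filter_upwards [ae_Ioo] with t ht
      by_cases htx : t ∈ Iio x
      · have : c ≤ g t := hg ht hx (le_of_lt htx)
        simp [indicator_of_mem htx, this]
      · have : g t ≤ c := hg hx ht (not_lt.1 htx)
        simp [indicator_of_notMem htx, this]
    have := sub fi
    have := sub gi
    linarith
  · have h1 := hcx _ (convexOn_id convex_univ)
    have h2 := hcx (fun y => -y) (concaveOn_id convex_univ).neg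
    rw [integral_neg, integral_neg] at h2
    simp only [id] at h1
    exact le_antisymm h1 (by linarith! )

/-- Lebesgue measure on the unit cube. -/
def cube (d : ℕ) : Measure (Fin d → ℝ) :=
  volume.restrict (Set.pi Set.univ fun _ : Fin d => Set.Ioo (0 : ℝ) 1)

lemma cube_ms (d : ℕ) : MeasurableSet (Set.pi Set.univ fun _ : Fin d => Set.Ioo (0 : ℝ) 1) :=
  MeasurableSet.univ_pi fun _ => measurableSet_Ioo

instance (d : ℕ) : IsProbabilityMeasure (cube d) := ⟨by
  simp [cube, Real.volume_pi_Ioo]⟩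

lemma rearr_law {d : ℕ} {f : (Fin d → ℝ) → ℝ} (hf : Measurable f) {fs : ℝ → ℝ}
    (h : IsDecRearrangement f fs) : unif01.map fs = (cube d).map f := by
  have ham := anti_aem h.1
  have : IsProbabilityMeasure (unif01.map fs) := Measure.isProbabilityMeasure_map ham
  apply Measure.ext_of_Ici
  intro w
  rw [Measure.map_apply_of_aemeasurable ham measurableSet_Ici, Measure.map_apply hf measurableSet_Ici,
    unif01, Measure.restrict_apply' measurableSet_Ioo, cube, Measure.restrict_apply' (cube_ms d)]
  have := h.2 w
  convert this using 2
  · ext t; exact and_comm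
  · ext t; exact and_comm

lemma rearr_exists {d : ℕ} {f : (Fin d → ℝ) → ℝ} (hf : Measurable f) :
    ∃ fs, IsDecRearrangement f fs := by
  refine ⟨fun t => - quantRV (cube d) (fun x => - f x) t, ?_, ?_⟩
  · intro a ha b hb hab
    exact neg_le_neg (quant_mono hf.neg ha hb hab)
  · intro w
    set c := cdfRV (cube d) (fun x => - f x) (-w) with hc
    have hc0 : 0 ≤ c := measureReal_nonneg
    have hc1 : c ≤ 1 := measureReal_le_one
    have e1 : {t ∈ Ioo (0:ℝ) 1 | w ≤ - quantRV (cube d) (fun x => - f x) t} =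
        {t ∈ Ioo (0:ℝ) 1 | t ≤ c} := by
      ext t
      apply and_congr_right
      intro ht
      rw [le_neg]
      exact quant_le_iff hf.neg ht _
    have e2 : volume {t ∈ Ioo (0:ℝ) 1 | t ≤ c} = ENNReal.ofReal c := by
      rcases hc1.lt_or_eq with h | h
      · have : {t ∈ Ioo (0:ℝ) 1 | t ≤ c} = Ioc 0 c := by
          ext t
          constructor
          · rintro ⟨a, b⟩; exact ⟨a.1, b⟩
          · rintro ⟨a, b⟩; exact ⟨⟨a, b.trans_lt h⟩, b⟩
        rw [this]; simp
      · have : {t ∈ Ioo (0:ℝ) 1 | t ≤ c} = Ioo 0 1 := by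
          ext t
          constructor
          · rintro ⟨a, b⟩; exact a
          · intro a; exact ⟨a, by rw [h]; exact a.2.le⟩
        rw [this, h]; simp
    rw [e1, e2, hc, cdfRV, ENNReal.ofReal_toReal (measure_ne_top _ _), cube,
      Measure.restrict_apply' (cube_ms d)]
    congr 1
    ext x
    constructor
    · rintro ⟨a, b⟩; exact ⟨b, neg_le_neg_iff.1 a⟩
    · rintro ⟨a, b⟩; exact ⟨neg_le_neg b, a⟩

lemma schur_iff {d d' : ℕ} {f : (Fin d → ℝ) → ℝ} {g : (Fin d' → ℝ) → ℝ}
    (hf : Measurable f) (hg : Measurable g)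
    (hf1 : ∀ x, f x ∈ Icc (0:ℝ) 1) (hg1 : ∀ x, g x ∈ Icc (0:ℝ) 1) :
    SchurLE f g ↔ ∀ φ : ℝ → ℝ, ConvexOn ℝ univ φ →
      ∫ x, φ (f x) ∂(cube d) ≤ ∫ x, φ (g x) ∂(cube d') := by
  have ints : ∀ {d : ℕ} {f : (Fin d → ℝ) → ℝ} {fs : ℝ → ℝ}, Measurable f →
      IsDecRearrangement f fs → ∀ φ : ℝ → ℝ, ConvexOn ℝ univ φ →
      ∫ x, φ (f x) ∂(cube d) = ∫ t, φ (fs t) ∂unif01 := by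
    intro d f fs hf h φ hφ
    rw [← integral_map hf.aemeasurable (cvx_cont hφ).aestronglyMeasurable, ← rearr_law hf h,
      integral_map (anti_aem h.1) (cvx_cont hφ).aestronglyMeasurable]
  have bds : ∀ {d : ℕ} {f : (Fin d → ℝ) → ℝ} {fs : ℝ → ℝ}, Measurable f →
      IsDecRearrangement f fs → (∀ x, f x ∈ Icc (0:ℝ) 1) → ∀ᵐ t ∂unif01, fs t ∈ Icc (0:ℝ) 1 := by
    intro d f fs hf h h1
    apply ae_of_ae_map (anti_aem h.1)
    rw [rearr_law hf h]
    exact (ae_map_iff hf.aemeasurable (measurableSet_Icc (a := (0:ℝ)) (b := 1))).2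
      (Eventually.of_forall h1)
  constructor
  · rintro ⟨fs, gs, hfs, hgs, h1, h2⟩ φ hφ
    rw [ints hf hfs φ hφ, ints hg hgs φ hφ]
    exact hlp_forward hfs.1 hgs.1 (bds hf hfs hf1) (bds hg hgs hg1) h1 h2 hφ
  · intro h
    obtain ⟨fs, hfs⟩ := rearr_exists hf
    obtain ⟨gs, hgs⟩ := rearr_exists hg
    refine ⟨fs, gs, hfs, hgs, hlp_backward hfs.1 hgs.1 (bds hf hfs hf1) (bds hg hgs hg1) ?_⟩
    intro φ hφ
    rw [← ints hf hfs φ hφ, ← ints hg hgs φ hφ]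
    exact h φ hφ

end hlp
section condprob

variable {Ω : Type*} [MeasurableSpace Ω] {P : Measure Ω} [IsProbabilityMeasure P]

lemma ind_int {A : Set Ω} (hA : MeasurableSet A) :
    Integrable (A.indicator (fun _ => (1 : ℝ))) P := (integrable_const 1).indicator hA

lemma cp_aesm {β : Type*} [MeasurableSpace β] {X : Ω → β} (hX : Measurable X) (A : Set Ω) :
    AEStronglyMeasurable (condProb P X A) P :=
  (stronglyMeasurable_condExp.mono hX.comap_le).aestronglyMeasurable

lemma cp_mono {β : Type*} [MeasurableSpace β] (X : Ω → β) {A B : Set Ω}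
    (hA : MeasurableSet A) (hB : MeasurableSet B) (h : A ⊆ B) :
    condProb P X A ≤ᵐ[P] condProb P X B :=
  condExp_mono (ind_int hA) (ind_int hB) (Eventually.of_forall fun ω =>
    indicator_le_indicator_of_subset h (fun _ => zero_le_one) ω)

lemma cp_univ {β : Type*} [MeasurableSpace β] {X : Ω → β} (hX : Measurable X) :
    condProb P X univ = fun _ => (1:ℝ) := by
  unfold condProb
  rw [indicator_univ]
  exact condExp_const hX.comap_le 1

lemma cp_empty {β : Type*} [MeasurableSpace β] {X : Ω → β} (hX : Measurable X) :
    condProb P X ∅ = fun _ => (0:ℝ) := by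
  unfold condProb
  rw [indicator_empty]
  exact condExp_const hX.comap_le 0

lemma cp_mem {β : Type*} [MeasurableSpace β] {X : Ω → β} (hX : Measurable X) {A : Set Ω}
    (hA : MeasurableSet A) : ∀ᵐ ω ∂P, condProb P X A ω ∈ Icc (0:ℝ) 1 := by
  have h0 := cp_mono (P := P) X MeasurableSet.empty hA (empty_subset A)
  have h1 := cp_mono (P := P) X hA MeasurableSet.univ (subset_univ A)
  rw [cp_empty hX] at h0
  rw [cp_univ hX] at h1
  filter_upwards [h0, h1] with ω a b using ⟨a, b⟩

lemma cp_integrable {β : Type*} [MeasurableSpace β] {X : Ω → β} {A : Set Ω} :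
    Integrable (condProb P X A) P := integrable_condExp

lemma cp_integral {β : Type*} [MeasurableSpace β] {X : Ω → β} (hX : Measurable X) {A : Set Ω}
    (hA : MeasurableSet A) : ∫ ω, condProb P X A ω ∂P = P.real A := by
  unfold condProb
  rw [integral_condExp hX.comap_le, integral_indicator_const _ hA]
  simp

lemma cp_compl {β : Type*} [MeasurableSpace β] {X : Ω → β} (hX : Measurable X) {A : Set Ω}
    (hA : MeasurableSet A) : ∀ᵐ ω ∂P, condProb P X Aᶜ ω = 1 - condProb P X A ω := by
  have h := condExp_sub (μ := P) (integrable_const (1:ℝ)) (ind_int hA)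
    (MeasurableSpace.comap X inferInstance)
  have e : (fun _ => (1:ℝ)) - A.indicator (fun _ => (1:ℝ)) = Aᶜ.indicator (fun _ => (1:ℝ)) := by
    ext ω
    by_cases hω : ω ∈ A <;> simp [hω]
  rw [e, condExp_const hX.comap_le] at h
  exact h

lemma cp_approx {β : Type*} [MeasurableSpace β] {X : Ω → β} (hX : Measurable X) {A B : Set Ω}
    (hA : MeasurableSet A) (hB : MeasurableSet B) (h : A ⊆ B) {φ : ℝ → ℝ} (hφ : ConvexOn ℝ univ φ)
    {L : ℝ} (hL : ∀ x ∈ Icc (0:ℝ) 1, ∀ y ∈ Icc (0:ℝ) 1, |φ x - φ y| ≤ L * |x - y|) :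
    |∫ ω, φ (condProb P X A ω) ∂P - ∫ ω, φ (condProb P X B ω) ∂P| ≤ L * (P.real B - P.real A) := by
  have iA := cvx_integrable (cvx_cont hφ) (cp_aesm hX A) (cp_mem (P := P) hX hA)
  have iB := cvx_integrable (cvx_cont hφ) (cp_aesm hX B) (cp_mem (P := P) hX hB)
  rw [← integral_sub iA iB, ← cp_integral (P := P) hX hA, ← cp_integral (P := P) hX hB,
    ← integral_sub cp_integrable cp_integrable, ← integral_const_mul]
  refine (abs_integral_le_integral_abs).trans ?_
  apply integral_mono_ae (iA.sub iB).abs ((cp_integrable.sub cp_integrable).const_mul L)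
  filter_upwards [cp_mem (P := P) hX hA, cp_mem (P := P) hX hB, cp_mono (P := P) X hA hB h]
    with ω a b c
  refine (hL _ a _ b).trans ?_
  rw [abs_sub_comm, abs_of_nonneg (sub_nonneg.2 c)]
  exact le_rfl

/-- flipping complements preserves the convex order -/
lemma cx_flip {β γ : Type*} [MeasurableSpace β] [MeasurableSpace γ] {X : Ω → β} {X' : Ω → γ}
    (hX : Measurable X) (hX' : Measurable X') {A B : Set Ω}
    (hA : MeasurableSet A) (hB : MeasurableSet B)
    (h : CxLE P (condProb P X A) P (condProb P X' B)) :
    CxLE P (condProb P X Aᶜ) P (condProb P X' Bᶜ) := by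
  intro φ hφ
  have hφ' : ConvexOn ℝ univ (fun y => φ (1 - y)) := by
    refine ⟨convex_univ, fun x _ y _ a b ha hb hab => ?_⟩
    have := hφ.2 (mem_univ (1 - x)) (mem_univ (1 - y)) ha hb hab
    simp only [smul_eq_mul] at this ⊢
    convert this using 2
    linear_combination (-1 : ℝ) * hab
  have := h _ hφ'
  have e : ∀ {δ : Type _} [MeasurableSpace δ] {Z : Ω → δ}, Measurable Z → ∀ {A : Set Ω},
      MeasurableSet A → ∫ ω, φ (condProb P Z Aᶜ ω) ∂P = ∫ ω, φ (1 - condProb P Z A ω) ∂P := by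
    intro δ _ Z hZ A hA
    apply integral_congr_ae
    filter_upwards [cp_compl (P := P) hZ hA] with ω hω
    rw [hω]
  have e' : ∫ ω, φ (condProb P X' Bᶜ ω) ∂P = ∫ ω, φ (1 - condProb P X' B ω) ∂P := by
    apply integral_congr_ae
    filter_upwards [cp_compl (P := P) hX' hB] with ω hω
    rw [hω]
  rw [e hX hA, e']
  exact this

/-- the convex order passes to approximations -/
lemma cx_limit {β γ : Type*} [MeasurableSpace β] [MeasurableSpace γ] {X : Ω → β} {X' : Ω → γ}
    (hX : Measurable X) (hX' : Measurable X') {A B : Set Ω}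
    (hA : MeasurableSet A) (hB : MeasurableSet B)
    (h : ∀ ε > (0:ℝ), ∃ A' B' : Set Ω, MeasurableSet A' ∧ MeasurableSet B' ∧
      (A' ⊆ A ∨ A ⊆ A') ∧ (B' ⊆ B ∨ B ⊆ B') ∧ |P.real A - P.real A'| ≤ ε ∧
      |P.real B - P.real B'| ≤ ε ∧ CxLE P (condProb P X A') P (condProb P X' B')) :
    CxLE P (condProb P X A) P (condProb P X' B) := by
  intro φ hφ
  obtain ⟨L, hL0, hL⟩ := cvx_lip hφ
  apply le_of_forall_pos_le_add
  intro ε hε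
  obtain ⟨A', B', hA', hB', hAA, hBB, h1, h2, h3⟩ := h (ε / (2 * (L + 1))) (by positivity)
  have h4 := h3 φ hφ
  have hb : L * (ε / (2 * (L + 1))) ≤ ε / 2 := by
    rw [mul_div_assoc', div_le_div_iff₀ (by positivity) (by positivity)]
    nlinarith
  have k1 : |∫ ω, φ (condProb P X A ω) ∂P - ∫ ω, φ (condProb P X A' ω) ∂P| ≤ ε / 2 := by
    rcases hAA with hs | hs
    · have := cp_approx (P := P) hX hA' hA hs hφ hL
      rw [abs_sub_comm]
      exact this.trans ((mul_le_mul_of_nonneg_left ((le_abs_self _).trans h1) hL0).trans hb)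
    · have := cp_approx (P := P) hX hA hA' hs hφ hL
      rw [abs_sub_comm] at h1
      exact this.trans ((mul_le_mul_of_nonneg_left ((le_abs_self _).trans h1) hL0).trans hb)
  have k2 : |∫ ω, φ (condProb P X' B ω) ∂P - ∫ ω, φ (condProb P X' B' ω) ∂P| ≤ ε / 2 := by
    rcases hBB with hs | hs
    · have := cp_approx (P := P) hX' hB' hB hs hφ hL
      rw [abs_sub_comm]
      exact this.trans ((mul_le_mul_of_nonneg_left ((le_abs_self _).trans h2) hL0).trans hb)
    · have := cp_approx (P := P) hX' hB hB' hs hφ hL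
      rw [abs_sub_comm] at h2
      exact this.trans ((mul_le_mul_of_nonneg_left ((le_abs_self _).trans h2) hL0).trans hb)
  rw [abs_le] at k1 k2
  linarith [k1.2, k2.1]

lemma cx_mean {β γ : Type*} [MeasurableSpace β] [MeasurableSpace γ] {X : Ω → β} {X' : Ω → γ}
    (hX : Measurable X) (hX' : Measurable X') {A B : Set Ω}
    (hA : MeasurableSet A) (hB : MeasurableSet B)
    (h : CxLE P (condProb P X A) P (condProb P X' B)) : P.real A = P.real B := by
  have h1 := h _ (convexOn_id convex_univ)
  have h2 := h (fun y => -y) (concaveOn_id convex_univ).neg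
  rw [integral_neg, integral_neg] at h2
  simp only [id] at h1
  rw [cp_integral hX hA, cp_integral hX' hB] at h1 h2
  linarith

lemma real_GE {Y : Ω → ℝ} (hY : Measurable Y) (v : ℝ) :
    P.real {ω | quantRV P Y v ≤ Y ω} = 1 - GG P Y v := by
  have h := probReal_compl_eq_one_sub (μ := P) (measurableSet_lt hY (measurable_const (a := quantRV P Y v)))
  rw [GG, ← h]
  congr 1
  ext ω
  simp

lemma real_GT {Y : Ω → ℝ} (hY : Measurable Y) (v : ℝ) :
    P.real {ω | quantRV P Y v < Y ω} = 1 - HH P Y v := by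
  have h := probReal_compl_eq_one_sub (μ := P) (measurableSet_le hY (measurable_const (a := quantRV P Y v)))
  have e : HH P Y v = P.real {ω | Y ω ≤ quantRV P Y v} := rfl
  rw [e, ← h]
  congr 1
  ext ω
  simp

lemma ms_GE {Y : Ω → ℝ} (hY : Measurable Y) (y : ℝ) : MeasurableSet {ω | y ≤ Y ω} :=
  measurableSet_le measurable_const hY
lemma ms_GT {Y : Ω → ℝ} (hY : Measurable Y) (y : ℝ) : MeasurableSet {ω | y < Y ω} :=
  measurableSet_lt measurable_const hY
lemma ms_LE {Y : Ω → ℝ} (hY : Measurable Y) (y : ℝ) : MeasurableSet {ω | Y ω ≤ y} :=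
  measurableSet_le hY measurable_const

lemma ccx_iff_GT {β γ : Type*} [MeasurableSpace β] [MeasurableSpace γ] {X : Ω → β} {X' : Ω → γ}
    (hX : Measurable X) (hX' : Measurable X') {Y Y' : Ω → ℝ} (hY : Measurable Y)
    (hY' : Measurable Y') :
    CCX P Y X P Y' X' ↔ ∀ᵐ v ∂unif01,
      CxLE P (condProbGT P Y X (quantRV P Y v)) P (condProbGT P Y' X' (quantRV P Y' v)) := by
  constructor
  · intro h
    have hG : ∀ v ∈ Ioo (0:ℝ) 1, GG P Y v = GG P Y' v := by
      intro v hv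
      have := cx_mean hX hX' (ms_GE hY _) (ms_GE hY' _) (h v hv)
      rw [real_GE hY, real_GE hY'] at this
      linarith
    filter_upwards [HH_ae_eq hY hY' hG, ae_Ioo] with v hH hv
    apply cx_limit hX hX' (ms_GT hY _) (ms_GT hY' _)
    intro ε hε
    have hH1 : HH P Y v ≤ 1 := measureReal_le_one
    rcases hH1.lt_or_eq with hlt | heq
    · set w := min (HH P Y v + ε) ((HH P Y v + 1) / 2) with hw
      have hw1 : HH P Y v < w := lt_min (by linarith) (by linarith)
      have hw2 : w ≤ HH P Y v + ε := min_le_left _ _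
      have hw3 : w < 1 := (min_le_right _ _).trans_lt (by linarith)
      have hwm : w ∈ Ioo (0:ℝ) 1 := ⟨by linarith [hv.1, le_HH (P := P) hY hv], hw3⟩
      have q1 := quant_lt_of_HH_lt hY hwm hw1
      have q2 := quant_lt_of_HH_lt hY' hwm (hH ▸ hw1)
      refine ⟨{ω | quantRV P Y w ≤ Y ω}, {ω | quantRV P Y' w ≤ Y' ω}, ms_GE hY _, ms_GE hY' _,
        Or.inl (fun ω (hω : _ ≤ _) => q1.trans_le hω), Or.inl (fun ω (hω : _ ≤ _) => q2.trans_le hω),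
        ?_, ?_, h w hwm⟩
      · rw [real_GE hY, real_GT hY, abs_le]
        have a := HH_le_GG (P := P) q1
        have b := GG_le (P := P) hY hwm
        constructor <;> linarith
      · rw [real_GE hY', real_GT hY', abs_le]
        have a := HH_le_GG (P := P) q2
        have b := GG_le (P := P) hY' hwm
        constructor <;> linarith
    · refine ⟨∅, ∅, MeasurableSet.empty, MeasurableSet.empty, Or.inl (empty_subset _),
        Or.inl (empty_subset _), ?_, ?_, ?_⟩
      · rw [real_GT hY, heq]; simpa using hε.le
      · rw [real_GT hY', ← hH, heq]; simpa using hε.le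
      · rw [cp_empty hX, cp_empty hX']
        intro φ _
        exact le_rfl
  · intro h v hv
    have hH : ∀ᵐ v ∂unif01, HH P Y v = HH P Y' v := by
      filter_upwards [h] with v hv
      have := cx_mean hX hX' (ms_GT hY _) (ms_GT hY' _) hv
      rw [real_GT hY, real_GT hY'] at this
      linarith
    have hG : GG P Y v = GG P Y' v :=
      le_antisymm (GG_le_of_HH_eq hY' hY (hH.mono fun _ h => h.symm) hv)
        (GG_le_of_HH_eq hY hY' hH hv)
    apply cx_limit hX hX' (ms_GE hY _) (ms_GE hY' _)
    intro ε hε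
    have hG0 : 0 ≤ GG P Y v := measureReal_nonneg
    have hGv := GG_le (P := P) hY hv
    rcases hG0.lt_or_eq with hlt | heq
    · obtain ⟨w, hw1, hw2, hw3⟩ := exists_good h (a := max 0 (GG P Y v - ε)) (b := GG P Y v)
        (le_max_left _ _) (max_lt hlt (by linarith)) (hGv.trans hv.2.le)
      have hw4 : GG P Y v - ε < w := (le_max_right _ _).trans_lt hw1
      have hw0 : 0 < w := (le_max_left _ _).trans_lt hw1
      have hwm : w ∈ Ioo (0:ℝ) 1 := ⟨hw0, by linarith [hv.2]⟩
      have q1 := quant_lt_of_lt_GG hY hv hwm hw2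
      have q2 := quant_lt_of_lt_GG hY' hv hwm (hG ▸ hw2)
      refine ⟨{ω | quantRV P Y w < Y ω}, {ω | quantRV P Y' w < Y' ω}, ms_GT hY _, ms_GT hY' _,
        Or.inr (fun ω (hω : _ ≤ _) => q1.trans_le hω), Or.inr (fun ω (hω : _ ≤ _) => q2.trans_le hω),
        ?_, ?_, hw3⟩
      · rw [real_GE hY, real_GT hY, abs_le]
        have a := HH_le_GG (P := P) q1
        have b := le_HH (P := P) hY hwm
        constructor <;> linarith
      · rw [real_GE hY', real_GT hY', abs_le]
        have a := HH_le_GG (P := P) q2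
        have b := le_HH (P := P) hY' hwm
        constructor <;> linarith
    · refine ⟨univ, univ, MeasurableSet.univ, MeasurableSet.univ, Or.inr (subset_univ _),
        Or.inr (subset_univ _), ?_, ?_, ?_⟩
      · rw [real_GE hY, ← heq]; simpa using hε.le
      · rw [real_GE hY', ← hG, ← heq]; simpa using hε.le
      · rw [cp_univ hX, cp_univ hX']
        intro φ _
        exact le_rfl

end condprob

end CCXPaper

open CCXPaper in
/-- Characterization of the conditional convex order by the Schur order:
with `η^v`, `η'^v` Borel functions on the unit cubes whose pushforwards of Lebesgue
measure equal the laws of `P(Y ≤ q_Y(v) | X)` and `P(Y' ≤ q_{Y'}(v) | X')`, one has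
`(Y, X) ⪯ccx (Y', X')` iff `η^v ≺_S η'^v` for Lebesgue-a.e. `v ∈ (0,1)`. -/
theorem ccx_iff_schur_order
    {Ω : Type*} [MeasurableSpace Ω] (P : Measure Ω) [IsProbabilityMeasure P]
    (hPna : Nonatomic P)
    {p p' : ℕ} (Y Y' : Ω → ℝ) (X : Ω → Fin p → ℝ) (X' : Ω → Fin p' → ℝ)
    (hY : Measurable Y) (hX : Measurable X)
    (hY' : Measurable Y') (hX' : Measurable X')
    (η : ℝ → (Fin p → ℝ) → ℝ) (η' : ℝ → (Fin p' → ℝ) → ℝ)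
    (hη : ∀ v ∈ Set.Ioo (0 : ℝ) 1, Measurable (η v) ∧ (∀ x, η v x ∈ Set.Icc (0 : ℝ) 1) ∧
      (volume.restrict (Set.pi Set.univ fun _ : Fin p => Set.Ioo (0 : ℝ) 1)).map (η v) =
        P.map (condProbLE P Y X (quantRV P Y v)))
    (hη' : ∀ v ∈ Set.Ioo (0 : ℝ) 1, Measurable (η' v) ∧ (∀ x, η' v x ∈ Set.Icc (0 : ℝ) 1) ∧
      (volume.restrict (Set.pi Set.univ fun _ : Fin p' => Set.Ioo (0 : ℝ) 1)).map (η' v) =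
        P.map (condProbLE P Y' X' (quantRV P Y' v))) :
    CCX P Y X P Y' X' ↔ ∀ᵐ v ∂unif01, SchurLE (η v) (η' v) := by
  rw [ccx_iff_GT hX hX' hY hY']
  have key : ∀ v ∈ Set.Ioo (0:ℝ) 1,
      (CxLE P (condProbGT P Y X (quantRV P Y v)) P (condProbGT P Y' X' (quantRV P Y' v)) ↔
        SchurLE (η v) (η' v)) := by
    intro v hv
    obtain ⟨m1, b1, l1⟩ := hη v hv
    obtain ⟨m2, b2, l2⟩ := hη' v hv
    have i1 : ∀ φ : ℝ → ℝ, ConvexOn ℝ Set.univ φ → ∫ x, φ (η v x) ∂(cube p) =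
        ∫ ω, φ (condProbLE P Y X (quantRV P Y v) ω) ∂P := by
      intro φ hφ
      rw [← integral_map m1.aemeasurable (cvx_cont hφ).aestronglyMeasurable, cube, l1]
      exact integral_map (cp_aesm hX _).aemeasurable (cvx_cont hφ).aestronglyMeasurable
    have i2 : ∀ φ : ℝ → ℝ, ConvexOn ℝ Set.univ φ → ∫ x, φ (η' v x) ∂(cube p') =
        ∫ ω, φ (condProbLE P Y' X' (quantRV P Y' v) ω) ∂P := by
      intro φ hφ
      rw [← integral_map m2.aemeasurable (cvx_cont hφ).aestronglyMeasurable, cube, l2]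
      exact integral_map (cp_aesm hX' _).aemeasurable (cvx_cont hφ).aestronglyMeasurable
    have c1 : {ω | Y ω ≤ quantRV P Y v}ᶜ = {ω | quantRV P Y v < Y ω} := by ext ω; simp
    have c2 : {ω | Y' ω ≤ quantRV P Y' v}ᶜ = {ω | quantRV P Y' v < Y' ω} := by ext ω; simp
    rw [schur_iff m1 m2 b1 b2]
    constructor
    · intro h φ hφ
      rw [i1 φ hφ, i2 φ hφ]
      have h' := cx_flip hX hX' (ms_GT hY _) (ms_GT hY' _) h
      rw [← c1, ← c2, compl_compl, compl_compl] at h'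
      exact h' φ hφ
    · intro h
      have h' : CxLE P (condProb P X {ω | Y ω ≤ quantRV P Y v}) P
          (condProb P X' {ω | Y' ω ≤ quantRV P Y' v}) := by
        intro φ hφ
        have := h φ hφ
        rw [i1 φ hφ, i2 φ hφ] at this
        exact this
      have h2 := cx_flip hX hX' (ms_LE hY _) (ms_LE hY' _) h'
      rw [c1, c2] at h2
      exact h2
  constructor
  · intro h
    filter_upwards [h, ae_Ioo] with v a hv using (key v hv).1 a
  · intro h
    filter_upwards [h, ae_Ioo] with v a hv using (key v hv).2 a
end
end
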